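/- arXiv:math/0302079 — 8 statements merged into one kernel-verified Lean document; each statement's English description precedes it below -/
import Mathlib

section
/- Let N = 1 + Σ_{i=1}^n m_i − n. There exists a subset T ⊆ Ω with |T| = N that is shattered by the threshold-set family of the strictly positive product distributions on Ω; consequently the VC dimension of the family of strictly positive product distributions on Ω is at least N. (A shattered set of this size is given by the base tuple (x_{1;0},…,x_{n;0}) for arbitrarily fixed base points x_{i;0} ∈ Ω_i, together with the Σ_i(m_i−1) tuples obtained from it by changing exactly one coordinate x_{i;0} to one of the other elements of Ω_i.) -/
open Finset MeasureTheory

/-- A family of subsets of `S` shatters a finite set `T` if every subset of `T`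
is cut out as `A ∩ T` for some `A` in the family. -/
def ShattersFam {S : Type*} (C : Set (Set S)) (T : Finset S) : Prop :=
  ∀ U : Finset S, U ⊆ T → ∃ A ∈ C, A ∩ (T : Set S) = (U : Set S)

/-- The VC dimension of a family of subsets: the supremum of cardinalities of
shattered finite sets. -/
noncomputable def vcDim {S : Type*} (C : Set (Set S)) : ℕ∞ :=
  ⨆ (T : Finset S) (_ : ShattersFam C T), (T.card : ℕ∞)

/-- The threshold-set family `{{s | f s ≥ μ}}` of a family of real-valued functions. -/
def thresholdFam {S : Type*} (F : Set (S → ℝ)) : Set (Set S) :=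
  {A | ∃ f ∈ F, ∃ μ : ℝ, A = {s | μ ≤ f s}}

/-- The family of strictly positive product distributions on `Π i, Ωi i`. -/
def productDists {n : ℕ} (Ωi : Fin n → Type*) [∀ i, Fintype (Ωi i)] :
    Set ((∀ i, Ωi i) → ℝ) :=
  {P | ∃ p : ∀ i, Ωi i → ℝ, (∀ i w, 0 < p i w) ∧ (∀ i, ∑ w, p i w = 1) ∧
        ∀ x, P x = ∏ i, p i (x i)}

open Classical in
/-- The point `b` together with all points that differ from it in exactly one coordinate. -/
noncomputable def unitHammingBall {ι : Type*} [Fintype ι] {Ω : ι → Type*} [∀ i, Fintype (Ω i)]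
    (b : ∀ i, Ω i) : Finset (∀ i, Ω i) :=
  insert b (univ.image fun s : (i : ι) × {w : Ω i // w ≠ b i} ↦ Function.update b s.1 s.2)

theorem card_unitHammingBall {ι : Type*} [Fintype ι] {Ω : ι → Type*} [∀ i, Fintype (Ω i)]
    (b : ∀ i, Ω i) : (unitHammingBall b).card = 1 + ∑ i, (Fintype.card (Ω i) - 1) := by
  classical
  have h_inj : Function.Injective
      fun s : (i : ι) × {w : Ω i // w ≠ b i} ↦ Function.update b s.1 (s.2 : Ω s.1) := by
    rintro ⟨i, w, hw⟩ ⟨j, v, hv⟩ h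
    have hi := congrFun h i
    by_cases hij : i = j
    · subst hij
      simpa using hi
    · simp [Function.update_of_ne hij, hw] at hi
  have h_notMem : b ∉ univ.image
      fun s : (i : ι) × {w : Ω i // w ≠ b i} ↦ Function.update b s.1 (s.2 : Ω s.1) := by
    simp only [mem_image, mem_univ, true_and, not_exists]
    rintro ⟨i, w, hw⟩ h
    exact hw (by simpa using congrFun h i)
  have h_card : ∀ i, Fintype.card {w : Ω i // w ≠ b i} = Fintype.card (Ω i) - 1 := fun i ↦ by
    simp [Fintype.card_subtype_compl]
  unfold unitHammingBall
  convert (card_insert_of_notMem h_notMem) using 1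
  rw [card_image_of_injective _ h_inj, card_univ, Fintype.card_sigma, add_comm]
  simp only [h_card]

theorem exists_eq_update_of_mem_unitHammingBall {ι : Type*} [Fintype ι] [DecidableEq ι]
    [Nonempty ι] {Ω : ι → Type*} [∀ i, Fintype (Ω i)] {b x : ∀ i, Ω i}
    (hx : x ∈ unitHammingBall b) : ∃ i w, x = Function.update b i w := by
  classical
  simp only [unitHammingBall, mem_insert, mem_image, mem_univ, true_and] at hx
  obtain rfl | ⟨s, rfl⟩ := hx
  · exact ⟨Classical.arbitrary ι, _, (Function.update_eq_self _ _).symm⟩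
  · exact ⟨s.1, s.2, by congr!⟩

/-- Superlevel sets of unnormalized positive product weights are threshold sets of
product distributions. -/
theorem setOf_le_prod_mem_thresholdFam {n : ℕ} {Ω : Fin n → Type*} [∀ i, Fintype (Ω i)]
    [∀ i, Nonempty (Ω i)] (q : ∀ i, Ω i → ℝ) (hq : ∀ i w, 0 < q i w) (c : ℝ) :
    {x : ∀ i, Ω i | c ≤ ∏ i, q i (x i)} ∈ thresholdFam (productDists Ω) := by
  have hZ : ∀ i, 0 < ∑ w, q i w := fun i ↦ sum_pos (fun w _ ↦ hq i w) univ_nonempty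
  refine ⟨fun x ↦ ∏ i, q i (x i) / ∑ w, q i w,
    ⟨fun i w ↦ q i w / ∑ w, q i w, fun i w ↦ div_pos (hq i w) (hZ i), fun i ↦ ?_, fun x ↦ rfl⟩,
    c / ∏ i, ∑ w, q i w, ?_⟩
  · rw [← sum_div, div_self (hZ i).ne']
  · ext x
    simp only [Set.mem_ofPred_eq, prod_div_distrib]
    exact (div_le_div_iff_of_pos_right (prod_pos fun i _ ↦ hZ i)).symm

theorem shattersFam_unitHammingBall {n : ℕ} (hn : 1 ≤ n) {Ω : Fin n → Type*}
    [∀ i, Fintype (Ω i)] (b : ∀ i, Ω i) :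
    ShattersFam (thresholdFam (productDists Ω)) (unitHammingBall b) := by
  classical
  have : Nonempty (Fin n) := ⟨⟨0, hn⟩⟩
  have : ∀ i, Nonempty (Ω i) := fun i ↦ ⟨b i⟩
  intro U hU
  -- These weights equal `1` at every base coordinate, so the weight of a point of the ball is
  -- the weight of its only changed coordinate.
  let c : ℝ := if b ∈ U then 1 else 2
  let q : ∀ i, Ω i → ℝ := fun i w ↦ if Function.update b i w ∈ U then c else c / 2
  have hc : 0 < c := by dsimp only [c]; split_ifs <;> norm_num
  have hq : ∀ i w, 0 < q i w := fun i w ↦ by dsimp only [q]; split_ifs <;> positivity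
  have hqb : ∀ i, q i (b i) = 1 := fun i ↦ by
    simp only [q, c, Function.update_eq_self]
    split_ifs <;> norm_num
  have h_prod : ∀ i w, ∏ j, q j (Function.update b i w j) = q i w := fun i w ↦ by
    rw [prod_eq_single i (fun j _ hj ↦ by rw [Function.update_of_ne hj, hqb]) (by simp),
      Function.update_self]
  refine ⟨_, setOf_le_prod_mem_thresholdFam q hq c, ?_⟩
  have h_iff : ∀ x ∈ unitHammingBall b, c ≤ ∏ i, q i (x i) ↔ x ∈ U := by
    intro x hx
    obtain ⟨i, w, rfl⟩ := exists_eq_update_of_mem_unitHammingBall hx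
    rw [h_prod]
    by_cases h : Function.update b i w ∈ U
    · simp [q, h]
    · simp [q, h, hc]
  ext x
  simp only [Set.mem_inter_iff, Set.mem_ofPred_eq, mem_coe]
  exact ⟨fun h ↦ (h_iff x h.2).1 h.1, fun h ↦ ⟨(h_iff x (hU h)).2 h, hU h⟩⟩

theorem vcDim_productDists_lower_bound {n : ℕ} (hn : 1 ≤ n) (Ωi : Fin n → Type*)
    [∀ i, Fintype (Ωi i)] [∀ i, Nonempty (Ωi i)]
    (m : Fin n → ℕ) (hm : ∀ i, m i = Fintype.card (Ωi i))
    (N : ℕ) (hN : N = 1 + (∑ i, m i) - n) :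
    (∃ T : Finset (∀ i, Ωi i), T.card = N ∧
        ShattersFam (thresholdFam (productDists Ωi)) T) ∧
      (N : ℕ∞) ≤ vcDim (thresholdFam (productDists Ωi)) := by
  have b : ∀ i, Ωi i := fun i ↦ Classical.arbitrary _
  have h_shatters := shattersFam_unitHammingBall hn b
  have h_card : (unitHammingBall b).card = N := by
    have h_sum : ∑ i, m i = ∑ i, (Fintype.card (Ωi i) - 1) + n := by
      calc ∑ i, m i = ∑ i, ((Fintype.card (Ωi i) - 1) + 1) :=
            sum_congr rfl fun i _ ↦ by
              rw [hm, Nat.sub_add_cancel Fintype.card_pos]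
        _ = _ := by simp [sum_add_distrib]
    rw [card_unitHammingBall]
    omega
  refine ⟨⟨_, h_card, h_shatters⟩, ?_⟩
  rw [← h_card]
  exact le_iSup₂_of_le _ h_shatters le_rfl
end

section
/- Let N = 1 + Σ_{i=1}^n m_i − n. No subset of Ω of cardinality N + 1 is shattered by the threshold-set family of the strictly positive product distributions on Ω; combined with the existence of a shattered set of size N, the VC dimension of the family of strictly positive product distributions on Ω equals N. -/
open Finset MeasureTheory

/-- Threshold sets of strictly positive product distributions are exactly the superlevel sets of
sums of functions of the single coordinates. -/
theorem mem_thresholdFam_productDists_iff {n : ℕ} (Ωi : Fin n → Type*) [∀ i, Fintype (Ωi i)]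
    [∀ i, Nonempty (Ωi i)] (A : Set (∀ i, Ωi i)) :
    A ∈ thresholdFam (productDists Ωi) ↔
      ∃ (f : ∀ i, Ωi i → ℝ) (c : ℝ), A = {x | c ≤ ∑ i, f i (x i)} := by
  constructor
  · rintro ⟨P, ⟨p, hpos, -, hP⟩, μ, rfl⟩
    rcases le_or_gt μ 0 with hμ | hμ
    · refine ⟨fun _ _ => 0, 0, ?_⟩
      ext x
      simp only [Set.mem_ofPred_eq, hP, sum_const_zero, le_refl, iff_true]
      exact hμ.trans (prod_nonneg fun i _ => (hpos i _).le)
    · refine ⟨fun i w => Real.log (p i w), Real.log μ, ?_⟩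
      ext x
      simp only [Set.mem_ofPred_eq, hP]
      rw [← Real.log_prod (fun i _ => (hpos i _).ne'),
        Real.log_le_log_iff hμ (prod_pos fun i _ => hpos i _)]
  · rintro ⟨f, c, rfl⟩
    have hZ : ∀ i, 0 < ∑ w, Real.exp (f i w) := fun i =>
      sum_pos (fun w _ => Real.exp_pos _) univ_nonempty
    refine ⟨fun x => ∏ i, (Real.exp (f i (x i)) / ∑ w, Real.exp (f i w)),
      ⟨fun i w => Real.exp (f i w) / ∑ w, Real.exp (f i w),
        fun i w => div_pos (Real.exp_pos _) (hZ i), fun i => ?_, fun x => rfl⟩,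
      Real.exp c / ∏ i, ∑ w, Real.exp (f i w), ?_⟩
    · rw [← sum_div, div_self (hZ i).ne']
    · ext x
      simp only [Set.mem_ofPred_eq]
      rw [prod_div_distrib, ← Real.exp_sum,
        div_le_div_iff_of_pos_right (prod_pos fun i _ => hZ i), Real.exp_le_exp]

/-- The points of a product that differ from a base point `b` in at most one coordinate. -/
abbrev StarIndex {n : ℕ} {Ωi : Fin n → Type*} (b : ∀ i, Ωi i) : Type _ :=
  Option (Σ i, {w : Ωi i // w ≠ b i})

open Classical in
theorem card_starIndex {n : ℕ} {Ωi : Fin n → Type*} [∀ i, Fintype (Ωi i)] (b : ∀ i, Ωi i) :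
    Fintype.card (StarIndex b) = 1 + (∑ i, Fintype.card (Ωi i)) - n := by
  have h : ∑ i, Fintype.card {w : Ωi i // w ≠ b i} + n = ∑ i, Fintype.card (Ωi i) := by
    calc _ = ∑ i, (Fintype.card {w : Ωi i // w ≠ b i} + 1) := by simp [sum_add_distrib]
      _ = _ := sum_congr rfl fun i _ => by
        have : 0 < Fintype.card (Ωi i) := Fintype.card_pos_iff.mpr ⟨b i⟩
        rw [Fintype.card_subtype_compl, Fintype.card_subtype_eq]
        omega
  rw [Fintype.card_option, Fintype.card_sigma]
  omega

open Classical in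
/-- The point of the product indexed by an element of `StarIndex b`. -/
noncomputable def starPoint {n : ℕ} {Ωi : Fin n → Type*} (b : ∀ i, Ωi i) :
    StarIndex b → ∀ i, Ωi i
  | none => b
  | some ⟨i, w⟩ => Function.update b i w

theorem starPoint_injective {n : ℕ} {Ωi : Fin n → Type*} (b : ∀ i, Ωi i) :
    Function.Injective (starPoint b) := by
  classical
  rintro (_ | ⟨i, w, hw⟩) (_ | ⟨j, v, hv⟩) h
  · rfl
  · have := congrFun h j
    simp only [starPoint, Function.update_self] at this
    exact absurd this.symm hv
  · have := congrFun h i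
    simp only [starPoint, Function.update_self] at this
    exact absurd this hw
  · have h1 := congrFun h i
    simp only [starPoint, Function.update_self] at h1
    by_cases hij : i = j
    · subst hij
      simp only [Function.update_self] at h1
      subst h1
      rfl
    · rw [Function.update_of_ne hij] at h1
      exact absurd h1 hw

open Classical in
/-- Any prescribed values on the star are attained by a sum of functions of the coordinates. -/
theorem sum_update_sub_starPoint {n : ℕ} {Ωi : Fin n → Type*} (b : ∀ i, Ωi i)
    (s : (∀ i, Ωi i) → ℝ) (k : StarIndex b) :
    ∑ i, (s (Function.update b i (starPoint b k i)) - s b) = s (starPoint b k) - s b := by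
  rcases k with _ | ⟨j, w⟩
  · simp [starPoint]
  · rw [sum_eq_single j]
    · simp [starPoint]
    · intro i _ hij
      simp [starPoint, Function.update_of_ne hij]
    · simp

open Classical in
theorem shattersFam_image_starPoint {n : ℕ} (Ωi : Fin n → Type*) [∀ i, Fintype (Ωi i)]
    [∀ i, Nonempty (Ωi i)] (b : ∀ i, Ωi i) :
    ShattersFam (thresholdFam (productDists Ωi)) (univ.image (starPoint b)) := by
  intro U hU
  set s : (∀ i, Ωi i) → ℝ := fun x => if x ∈ U then 1 else -1 with hs
  refine ⟨{x | -s b ≤ ∑ i, (s (Function.update b i (x i)) - s b)},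
    (mem_thresholdFam_productDists_iff Ωi _).mpr
      ⟨fun i w => s (Function.update b i w) - s b, -s b, rfl⟩, ?_⟩
  have key : ∀ k, (-s b ≤ ∑ i, (s (Function.update b i (starPoint b k i)) - s b)) ↔
      starPoint b k ∈ U := fun k => by
    rw [sum_update_sub_starPoint, neg_le_sub_iff_le_add, le_add_iff_nonneg_left]
    simp only [hs]
    split_ifs with h <;> simp [h]
  ext x
  simp only [Set.mem_inter_iff, Set.mem_ofPred_eq, mem_coe]
  constructor
  · rintro ⟨h, hx⟩
    obtain ⟨k, -, rfl⟩ := mem_image.mp hx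
    exact (key k).mp h
  · intro hx
    have hT := hU hx
    obtain ⟨k, -, rfl⟩ := mem_image.mp hT
    exact ⟨(key k).mpr hx, hT⟩

open Classical in
/-- The coordinates of evaluation at `x` on sums of functions of the single coordinates. -/
noncomputable def starCoords {n : ℕ} {Ωi : Fin n → Type*} (b x : ∀ i, Ωi i) :
    StarIndex b → ℝ
  | none => 1
  | some ⟨i, w⟩ => if x i = w then 1 else 0

open Classical in
theorem sum_apply_eq_starCoords {n : ℕ} {Ωi : Fin n → Type*} [∀ i, Fintype (Ωi i)]
    (b x : ∀ i, Ωi i) (f : ∀ i, Ωi i → ℝ) (c : ℝ) :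
    ∑ i, f i (x i) - c = (∑ i, f i (b i) - c) * starCoords b x none +
      ∑ k : Σ i, {w : Ωi i // w ≠ b i},
        (f k.1 k.2 - f k.1 (b k.1)) * starCoords b x (some k) := by
  have h : ∀ i, ∑ w : {w : Ωi i // w ≠ b i},
      (f i w - f i (b i)) * starCoords b x (some ⟨i, w⟩) = f i (x i) - f i (b i) := fun i => by
    simp only [starCoords, mul_ite, mul_one, mul_zero]
    by_cases hx : x i = b i
    · rw [hx, sub_self]
      exact sum_eq_zero fun w _ => if_neg fun h => w.2 h.symm
    · rw [sum_eq_single (⟨x i, hx⟩ : {w : Ωi i // w ≠ b i})]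
      · simp
      · intro w _ hw
        exact if_neg fun h => hw (Subtype.ext h.symm)
      · simp
  rw [Fintype.sum_sigma]
  rw [sum_congr rfl fun i _ => h i, sum_sub_distrib, starCoords]
  ring

open Classical in
/-- More points than the dimension admit a nontrivial linear relation satisfied by all sums of
functions of the single coordinates. -/
theorem exists_relation_of_card_starIndex_lt {n : ℕ} {Ωi : Fin n → Type*}
    [∀ i, Fintype (Ωi i)] (b : ∀ i, Ωi i) (T : Finset (∀ i, Ωi i))
    (hT : Fintype.card (StarIndex b) < T.card) :
    ∃ a : T → ℝ, (∃ t, a t < 0) ∧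
      ∀ (f : ∀ i, Ωi i → ℝ) (c : ℝ), ∑ t, a t * (∑ i, f i (t.1 i) - c) = 0 := by
  have hdep : ¬ LinearIndependent ℝ fun t : T => starCoords b t.1 := fun h => by
    have := h.fintype_card_le_finrank
    rw [Module.finrank_fintype_fun_eq_card, Fintype.card_coe] at this
    omega
  obtain ⟨a, ha, t₀, ht₀⟩ := Fintype.not_linearIndependent_iff.mp hdep
  have hrel : ∀ (f : ∀ i, Ωi i → ℝ) (c : ℝ), ∑ t, a t * (∑ i, f i (t.1 i) - c) = 0 := by
    intro f c
    have hk : ∀ k, ∑ t, a t * starCoords b t.1 k = 0 := fun k => by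
      simpa using congrFun ha k
    rw [sum_congr rfl fun t _ => congrArg (a t * ·) (sum_apply_eq_starCoords b t.1 f c)]
    simp only [mul_add, sum_add_distrib, mul_sum (univ : Finset (Σ i, {w : Ωi i // w ≠ b i}))]
    rw [sum_comm (s := univ (α := T))]
    simp only [mul_left_comm (a _), ← mul_sum, hk, mul_zero, sum_const_zero, add_zero]
  rcases lt_or_gt_of_ne ht₀ with h | h
  · exact ⟨a, ⟨t₀, h⟩, hrel⟩
  · exact ⟨-a, ⟨t₀, by simpa using h⟩, fun f c => by
      simp only [Pi.neg_apply, neg_mul, sum_neg_distrib, hrel, neg_zero]⟩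

open Classical in
theorem not_shattersFam_of_card_starIndex_lt {n : ℕ} (Ωi : Fin n → Type*)
    [∀ i, Fintype (Ωi i)] [∀ i, Nonempty (Ωi i)] (b : ∀ i, Ωi i) (T : Finset (∀ i, Ωi i))
    (hT : Fintype.card (StarIndex b) < T.card) :
    ¬ ShattersFam (thresholdFam (productDists Ωi)) T := by
  intro hsh
  obtain ⟨a, ⟨t₀, ht₀⟩, ha⟩ := exists_relation_of_card_starIndex_lt b T hT
  obtain ⟨A, hA, hAU⟩ := hsh ((univ.filter fun t : T => 0 ≤ a t).map (Function.Embedding.subtype _))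
    (map_subtype_subset _)
  obtain ⟨f, c, rfl⟩ := (mem_thresholdFam_productDists_iff Ωi A).mp hA
  have hiff : ∀ t : T, c ≤ ∑ i, f i (t.1 i) ↔ 0 ≤ a t := fun t => by
    simpa using Set.ext_iff.mp hAU t.1
  have hpos : 0 < ∑ t, a t * (∑ i, f i (t.1 i) - c) := by
    have hneg : ∀ t, a t < 0 → 0 < a t * (∑ i, f i (t.1 i) - c) := fun t h =>
      mul_pos_of_neg_of_neg h
        (sub_neg.mpr (not_le.mp fun h' => absurd ((hiff t).mp h') (not_le.mpr h)))
    refine sum_pos' (fun t _ => ?_) ⟨t₀, mem_univ _, hneg t₀ ht₀⟩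
    rcases lt_or_ge (a t) 0 with h | h
    · exact (hneg t h).le
    · exact mul_nonneg h (sub_nonneg.mpr ((hiff t).mpr h))
  exact hpos.ne' (ha f c)

theorem vcDim_productDists_eq {n : ℕ} (hn : 1 ≤ n) (Ωi : Fin n → Type*)
    [∀ i, Fintype (Ωi i)] [∀ i, Nonempty (Ωi i)]
    (m : Fin n → ℕ) (hm : ∀ i, m i = Fintype.card (Ωi i))
    (N : ℕ) (hN : N = 1 + (∑ i, m i) - n) :
    (∀ T : Finset (∀ i, Ωi i), T.card = N + 1 →
        ¬ ShattersFam (thresholdFam (productDists Ωi)) T) ∧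
      vcDim (thresholdFam (productDists Ωi)) = (N : ℕ∞) := by
  classical
  obtain ⟨b⟩ : Nonempty (∀ i, Ωi i) := inferInstance
  have hcard : Fintype.card (StarIndex b) = N := by
    rw [card_starIndex, hN]
    simp only [hm]
  refine ⟨fun T hT => not_shattersFam_of_card_starIndex_lt Ωi b T (by omega),
    le_antisymm (iSup₂_le fun T hT => ?_) ?_⟩
  · by_contra h
    refine not_shattersFam_of_card_starIndex_lt Ωi b T ?_ hT
    rw [hcard]
    exact_mod_cast not_le.mp h
  · refine le_trans (le_of_eq ?_)
      (le_iSup₂ (univ.image (starPoint b)) (shattersFam_image_starPoint Ωi b))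
    rw [card_image_of_injective _ (starPoint_injective b), card_univ, hcard]
end

section
/- Let d ≥ 1. The family of closed affine halfspaces {x ∈ ℝ^d : ⟨a, x⟩ + b ≥ 0}, where a ranges over ℝ^d and b over ℝ, has VC dimension exactly d + 1: there exists a set of d + 1 points in ℝ^d that is shattered by this family, and no set of d + 2 points in ℝ^d is shattered by it. -/
open Finset

/-- The family of closed affine halfspaces in `ℝ^d`. -/
def halfspaces (d : ℕ) : Set (Set (Fin d → ℝ)) :=
  {A | ∃ (a : Fin d → ℝ) (b : ℝ), A = {x | 0 ≤ (∑ i, a i * x i) + b}}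

theorem ShattersFam.card_le_of_halfspaces {d : ℕ} {T : Finset (Fin d → ℝ)}
    (hT : ShattersFam (halfspaces d) T) : T.card ≤ d + 1 := by
  classical
  by_contra! hcard
  have hdep : ¬ AffineIndependent ℝ ((↑) : T → Fin d → ℝ) := fun hind ↦ by
    have h := hind.card_le_finrank_succ
    have h' := Submodule.finrank_le (vectorSpan ℝ (Set.range ((↑) : T → Fin d → ℝ)))
    rw [Module.finrank_fin_fun] at h'
    rw [Fintype.card_coe] at h
    omega
  obtain ⟨I, p, hpI, hpJ⟩ := Convex.radon_partition hdep
  obtain ⟨A, ⟨a, b, rfl⟩, hA⟩ :=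
    hT {x ∈ T | x ∈ ((↑) : T → Fin d → ℝ) '' I} (filter_subset _ _)
  have hmem : ∀ x : T, 0 ≤ (∑ i, a i * x.1 i) + b ↔ x ∈ I := fun x ↦ by
    simpa using Set.ext_iff.1 hA x.1
  have hlin : IsLinearMap ℝ fun x : Fin d → ℝ ↦ ∑ i, a i * x i :=
    (dotProductBilin ℝ ℝ a : (Fin d → ℝ) →ₗ[ℝ] ℝ).isLinear
  have h₁ : -b ≤ ∑ i, a i * p i :=
    convexHull_min (by
      rintro _ ⟨x, hx, rfl⟩
      have := (hmem x).2 hx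
      simp only [Set.mem_ofPred_eq]
      linarith) (convex_halfSpace_ge hlin (-b)) hpI
  have h₂ : ∑ i, a i * p i < -b :=
    convexHull_min (by
      rintro _ ⟨x, hx, rfl⟩
      have := mt (hmem x).1 hx
      simp only [Set.mem_ofPred_eq]
      linarith) (convex_halfSpace_lt hlin (-b)) hpJ
  exact h₁.not_gt h₂

theorem exists_shattersFam_halfspaces (d : ℕ) :
    ∃ T : Finset (Fin d → ℝ), T.card = d + 1 ∧ ShattersFam (halfspaces d) T := by
  classical
  refine ⟨insert 0 (univ.image fun i ↦ Pi.single i 1), ?_, fun U hU ↦ ?_⟩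
  · rw [card_insert_of_notMem (by simp), card_image_of_injective, card_univ, Fintype.card_fin]
    intro i j h
    by_contra hij
    simpa [hij] using congrFun h i
  · refine ⟨_, ⟨fun i ↦ if Pi.single i 1 ∈ U then 1 else -1,
      if 0 ∈ U then 1 / 2 else -1 / 2, rfl⟩, ?_⟩
    ext x
    have hzero : 0 ≤ (if (0 : Fin d → ℝ) ∈ U then (1 / 2 : ℝ) else -1 / 2) ↔ 0 ∈ U := by
      split_ifs with h <;> norm_num [h]
    have hsum (c : Fin d → ℝ) (i : Fin d) :
        ∑ j, c j * (Pi.single i 1 : Fin d → ℝ) j = c i := by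
      simp [Pi.single_apply]
    have hsingle (i : Fin d) :
        0 ≤ (∑ j, (if Pi.single j 1 ∈ U then (1 : ℝ) else -1) * (Pi.single i 1 : Fin d → ℝ) j) +
          (if (0 : Fin d → ℝ) ∈ U then (1 / 2 : ℝ) else -1 / 2) ↔ Pi.single i 1 ∈ U := by
      rw [hsum fun j ↦ if Pi.single j 1 ∈ U then (1 : ℝ) else -1]
      split_ifs with h <;> norm_num [h]
    constructor
    · rintro ⟨hx, hxT⟩
      simp only [coe_insert, coe_image, coe_univ, Set.image_univ, Set.mem_insert_iff,
        Set.mem_range] at hxT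
      obtain rfl | ⟨i, rfl⟩ := hxT
      · exact hzero.1 (by simpa using hx)
      · exact (hsingle i).1 hx
    · intro hx
      refine ⟨?_, hU hx⟩
      have hxT := hU hx
      simp only [mem_insert, mem_image, mem_univ, true_and] at hxT
      obtain rfl | ⟨i, rfl⟩ := hxT
      · simpa using hzero.2 hx
      · exact (hsingle i).2 hx

/-- The VC dimension of the family of closed affine halfspaces in `ℝ^d` equals `d + 1`. -/
theorem vcDim_halfspaces (d : ℕ) (hd : 1 ≤ d) :
    (∃ T : Finset (Fin d → ℝ), T.card = d + 1 ∧ ShattersFam (halfspaces d) T) ∧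
    (∀ T : Finset (Fin d → ℝ), T.card = d + 2 → ¬ ShattersFam (halfspaces d) T) ∧
    vcDim (halfspaces d) = ((d + 1 : ℕ) : ℕ∞) := by
  refine ⟨exists_shattersFam_halfspaces d, fun T hcard hT ↦ ?_, le_antisymm ?_ ?_⟩
  · have := hT.card_le_of_halfspaces
    omega
  · exact iSup₂_le fun T hT ↦ Nat.cast_le.2 hT.card_le_of_halfspaces
  · obtain ⟨T, hcard, hT⟩ := exists_shattersFam_halfspaces d
    rw [← hcard]
    exact le_iSup₂ (f := fun (T : Finset (Fin d → ℝ)) (_ : ShattersFam (halfspaces d) T) ↦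
      (T.card : ℕ∞)) T hT
end

section
/- Let S be a set and let W be a finite-dimensional linear subspace of the real vector space of all functions S → ℝ, with dim W = d. Then the threshold-set family {{s ∈ S : g(s) ≥ μ} : g ∈ W, μ ∈ ℝ} shatters no subset of S of cardinality d + 2. If moreover the constant function 1 belongs to W, then this family shatters no subset of S of cardinality d + 1. -/
open Finset

theorem thresholdFam_mono {S : Type*} {F G : Set (S → ℝ)} (h : F ⊆ G) :
    thresholdFam F ⊆ thresholdFam G := by
  rintro A ⟨f, hf, μ, rfl⟩
  exact ⟨f, h hf, μ, rfl⟩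

theorem ShattersFam.mono {S : Type*} {C D : Set (Set S)} {T : Finset S}
    (h : ShattersFam C T) (hCD : C ⊆ D) : ShattersFam D T := by
  intro U hU
  obtain ⟨A, hA, hAT⟩ := h U hU
  exact ⟨A, hCD hA, hAT⟩

/-- On a finite set with more than `dim V` points, the elements of `V` satisfy a nontrivial
linear relation between their values. -/
theorem exists_nontrivial_relation_of_finrank_lt_card {S : Type*}
    (V : Subspace ℝ (S → ℝ)) [FiniteDimensional ℝ V] (T : Finset S)
    (hT : Module.finrank ℝ V < T.card) :
    ∃ c : T → ℝ, (∀ f ∈ V, ∑ t, c t * f t = 0) ∧ ∃ t, c t ≠ 0 := by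
  have h_dep : ¬ LinearIndependent ℝ
      (fun t : T => ((LinearMap.proj (t : S) : (S → ℝ) →ₗ[ℝ] ℝ).comp V.subtype :
        Module.Dual ℝ V)) := by
    intro h
    have := h.fintype_card_le_finrank
    rw [Subspace.dual_finrank_eq, Fintype.card_coe] at this
    omega
  obtain ⟨c, hc, h_ne⟩ := Fintype.not_linearIndependent_iff.mp h_dep
  refine ⟨c, fun f hf => ?_, h_ne⟩
  simpa using LinearMap.congr_fun hc ⟨f, hf⟩

theorem not_shattersFam_thresholdFam_of_one_mem {S : Type*}
    (V : Subspace ℝ (S → ℝ)) [FiniteDimensional ℝ V] (h_one : (fun _ : S => (1 : ℝ)) ∈ V)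
    (T : Finset S) (hT : Module.finrank ℝ V < T.card) :
    ¬ ShattersFam (thresholdFam (V : Set (S → ℝ))) T := by
  intro h
  obtain ⟨c, hc, t₀, ht₀⟩ := exists_nontrivial_relation_of_finrank_lt_card V T hT
  have h_sum : ∑ t, c t = 0 := by simpa using hc _ h_one
  obtain ⟨t₁, ht₁⟩ : ∃ t, c t < 0 := by
    by_contra! h_nonneg
    exact ht₀ ((Finset.sum_eq_zero_iff_of_nonneg fun t _ => h_nonneg t).mp h_sum t₀
      (Finset.mem_univ _))
  obtain ⟨A, ⟨f, hf, μ, rfl⟩, hA⟩ :=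
    h ((Finset.univ.filter fun t : T => 0 ≤ c t).map (Function.Embedding.subtype _))
      (fun x hx => by
        obtain ⟨y, -, rfl⟩ := Finset.mem_map.mp hx
        exact y.2)
  have h_iff (t : T) : μ ≤ f t ↔ 0 ≤ c t := by
    have := Set.ext_iff.mp hA t
    simpa using this
  have h_zero : ∑ t, c t * (f t - μ) = 0 := by
    simp only [mul_sub, Finset.sum_sub_distrib, ← Finset.sum_mul, h_sum, hc f hf]
    simp
  have h_pos : 0 < ∑ t, c t * (f t - μ) := by
    refine Finset.sum_pos' (fun t _ => ?_) ⟨t₁, Finset.mem_univ _, ?_⟩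
    · rcases le_or_gt 0 (c t) with ht | ht
      · exact mul_nonneg ht (sub_nonneg.mpr ((h_iff t).mpr ht))
      · have := not_le.mp (mt (h_iff t).mp ht.not_ge)
        exact mul_nonneg_of_nonpos_of_nonpos ht.le (sub_nonpos.mpr this.le)
    · have := not_le.mp (mt (h_iff t₁).mp ht₁.not_ge)
      exact mul_pos_of_neg_of_neg ht₁ (sub_neg.mpr this)
  exact h_pos.ne' h_zero

/-- The threshold-set family of a `d`-dimensional subspace of real-valued functions
shatters no set of size `d + 2`, and if the subspace contains the constant function `1`,
it shatters no set of size `d + 1`. -/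
theorem vcDim_finiteDimensional_function_space {S : Type*}
    (W : Subspace ℝ (S → ℝ)) [FiniteDimensional ℝ W]
    (d : ℕ) (hd : Module.finrank ℝ W = d) :
    (∀ T : Finset S, T.card = d + 2 →
        ¬ ShattersFam (thresholdFam (W : Set (S → ℝ))) T) ∧
    ((fun _ : S => (1 : ℝ)) ∈ W →
      ∀ T : Finset S, T.card = d + 1 →
        ¬ ShattersFam (thresholdFam (W : Set (S → ℝ))) T) := by
  constructor
  · intro T hT h
    refine not_shattersFam_thresholdFam_of_one_mem (W ⊔ Submodule.span ℝ {fun _ : S => (1 : ℝ)})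
      (le_sup_right (a := W) (Submodule.mem_span_singleton_self _)) T ?_
      (h.mono (thresholdFam_mono fun f hf => le_sup_left (a := W) hf))
    have h_sup := Submodule.finrank_add_le_finrank_add_finrank W
      (Submodule.span ℝ {fun _ : S => (1 : ℝ)})
    have h_span := finrank_span_le_card (R := ℝ) ({fun _ : S => (1 : ℝ)} : Set (S → ℝ))
    simp only [Set.toFinset_singleton, Finset.card_singleton] at h_span
    omega
  · intro h_one T hT
    exact not_shattersFam_thresholdFam_of_one_mem W h_one T (by omega)
end

section
/- Let 1 ≤ k ≤ n and h_k = Σ_{J ⊆ {1,…,n}, |J| = k} ∏_{i∈J} m_i. Then no subset of Ω of cardinality h_k + 1 is shattered by the threshold-set family of 𝒫^k; that is, the VC dimension of the class 𝒫^k of k-factor distributions on Ω is at most h_k. -/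
open Finset

/-- The class `𝒫^k` of `k`-factor probability distributions on `Π i, Ωi i`:
those of the form `P x = ∏_{J, |J| = k} q_J (x restricted to J)` with all `q_J > 0`. -/
def kFactorDists {n : ℕ} (Ωi : Fin n → Type*) [∀ i, Fintype (Ωi i)] (k : ℕ) :
    Set ((∀ i, Ωi i) → ℝ) :=
  {P | (∑ x, P x = 1) ∧
    ∃ q : (J : Finset (Fin n)) → ((i : J) → Ωi i) → ℝ,
      (∀ J y, 0 < q J y) ∧
      ∀ x, P x = ∏ J ∈ Finset.univ.powersetCard k, q J (fun i => x i)}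

/-- Signs of `f - μ` cannot follow the signs of a linear relation satisfied by `log f` and by the
constants. -/
theorem not_shattersFam_of_relation {S : Type*} {F : Set (S → ℝ)} {T : Finset S} (c : T → ℝ)
    (hc : ∃ x, c x < 0) (hsum : ∑ x, c x = 0) (hpos : ∀ f ∈ F, ∀ x, 0 < f x)
    (hlog : ∀ f ∈ F, ∑ x : T, c x * Real.log (f x) = 0) :
    ¬ ShattersFam (thresholdFam F) T := by
  classical
  intro hT
  obtain ⟨A, ⟨f, hf, μ, rfl⟩, hA⟩ :=
    hT ((Finset.univ.filter fun x : T => 0 ≤ c x).map (Function.Embedding.subtype _)) (by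
      intro x hx
      simp only [Finset.mem_map, Function.Embedding.subtype_apply] at hx
      obtain ⟨y, -, rfl⟩ := hx
      exact y.2)
  have hiff : ∀ x : T, μ ≤ f x ↔ 0 ≤ c x := by
    intro x
    have := Set.ext_iff.mp hA x
    simpa using this
  obtain ⟨x₀, hx₀⟩ := hc
  have hμ : 0 < μ := by
    have : ¬ μ ≤ f x₀ := fun h => absurd ((hiff x₀).mp h) (not_le.mpr hx₀)
    exact (hpos f hf x₀).trans (not_le.mp this)
  have hzero : ∑ x : T, c x * (Real.log (f x) - Real.log μ) = 0 := by
    simp only [mul_sub, Finset.sum_sub_distrib, ← Finset.sum_mul, hsum, hlog f hf, zero_mul,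
      sub_zero]
  have hneg : ∀ x : T, c x < 0 → 0 < c x * (Real.log (f x) - Real.log μ) := by
    intro x hx
    have hlt : f x < μ := not_le.mp fun h => absurd ((hiff x).mp h) (not_le.mpr hx)
    exact mul_pos_of_neg_of_neg hx (sub_neg.mpr (Real.log_lt_log (hpos f hf x) hlt))
  refine (Finset.sum_pos' (fun x _ => ?_) ⟨x₀, Finset.mem_univ _, hneg x₀ hx₀⟩).ne' hzero
  rcases lt_or_ge (c x) 0 with hx | hx
  · exact (hneg x hx).le
  · exact mul_nonneg hx (sub_nonneg.mpr (Real.log_le_log hμ ((hiff x).mpr hx)))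

/-- More points than pairs `(J, y)`, with `J ∈ 𝒥` and `y` a configuration on `J`, carry a nontrivial
relation that annihilates every function depending only on the coordinates in some `J ∈ 𝒥`. -/
theorem exists_relation_of_sum_prod_card_lt {ι : Type*} (Ωi : ι → Type*)
    [∀ i, Fintype (Ωi i)] (𝒥 : Finset (Finset ι)) (T : Finset (∀ i, Ωi i))
    (hT : ∑ J ∈ 𝒥, ∏ i ∈ J, Fintype.card (Ωi i) < T.card) :
    ∃ c : T → ℝ, (∃ x, c x ≠ 0) ∧
      ∀ J ∈ 𝒥, ∀ g : ((i : J) → Ωi i) → ℝ, ∑ x : T, c x * g (fun i => x.1 i) = 0 := by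
  classical
  let φ : T → (Σ J : 𝒥, (i : J.1) → Ωi i) → ℝ :=
    fun x p => if (fun i : p.1.1 => x.1 i) = p.2 then 1 else 0
  have hφ : ¬ LinearIndependent ℝ φ := by
    intro h
    have hle := h.fintype_card_le_finrank
    have hcard : Fintype.card (Σ J : 𝒥, (i : J.1) → Ωi i) =
        ∑ J ∈ 𝒥, ∏ i ∈ J, Fintype.card (Ωi i) := by
      rw [Fintype.card_sigma, ← Finset.sum_coe_sort 𝒥]
      refine Finset.sum_congr rfl fun J _ => ?_
      rw [Fintype.card_pi, ← Finset.prod_coe_sort J.1]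
    rw [Module.finrank_fintype_fun_eq_card, hcard, Fintype.card_coe] at hle
    exact absurd hle (not_le.mpr hT)
  obtain ⟨c, hc, hne⟩ := Fintype.not_linearIndependent_iff.mp hφ
  refine ⟨c, hne, fun J hJ g => ?_⟩
  have hrel : ∀ y : (i : J) → Ωi i,
      ∑ x : T, c x * (if (fun i : J => x.1 i) = y then 1 else 0) = 0 := by
    intro y
    have := congrFun hc ⟨⟨J, hJ⟩, y⟩
    simpa only [Finset.sum_apply, Pi.smul_apply, smul_eq_mul, Pi.zero_apply] using this
  calc ∑ x : T, c x * g (fun i => x.1 i)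
      = ∑ x : T, ∑ y, g y * (c x * (if (fun i : J => x.1 i) = y then 1 else 0)) := by
        refine Finset.sum_congr rfl fun x _ => ?_
        simp [mul_comm]
    _ = ∑ y, g y * ∑ x : T, c x * (if (fun i : J => x.1 i) = y then 1 else 0) := by
        rw [Finset.sum_comm]
        simp only [Finset.mul_sum]
    _ = 0 := by simp only [hrel, mul_zero, Finset.sum_const_zero]

theorem not_shattersFam_kFactorDists {n : ℕ} (Ωi : Fin n → Type*) [∀ i, Fintype (Ωi i)]
    {k : ℕ} (hkn : k ≤ n) (T : Finset (∀ i, Ωi i))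
    (hT : ∑ J ∈ Finset.univ.powersetCard k, ∏ i ∈ J, Fintype.card (Ωi i) < T.card) :
    ¬ ShattersFam (thresholdFam (kFactorDists Ωi k)) T := by
  obtain ⟨c, ⟨x₀, hx₀⟩, hc⟩ := exists_relation_of_sum_prod_card_lt Ωi _ T hT
  obtain ⟨J₀, hJ₀⟩ : (Finset.univ.powersetCard k : Finset (Finset (Fin n))).Nonempty :=
    Finset.powersetCard_nonempty.mpr (by simpa using hkn)
  have hsum : ∑ x, c x = 0 := by simpa using hc J₀ hJ₀ fun _ => 1
  have hneg : ∃ x, c x < 0 := by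
    by_contra! h
    exact hx₀ ((Finset.sum_eq_zero_iff_of_nonneg fun x _ => h x).mp hsum x₀ (Finset.mem_univ _))
  refine not_shattersFam_of_relation c hneg hsum ?_ ?_
  · rintro P ⟨-, q, hq, hP⟩ x
    rw [hP]
    exact Finset.prod_pos fun J _ => hq J _
  · rintro P ⟨-, q, hq, hP⟩
    have hlog : ∀ x : T, Real.log (P x) =
        ∑ J ∈ Finset.univ.powersetCard k, Real.log (q J fun i => x.1 i) := fun x => by
      rw [hP, Real.log_prod fun J _ => (hq J _).ne']
    simp only [hlog, Finset.mul_sum]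
    rw [Finset.sum_comm]
    exact Finset.sum_eq_zero fun J hJ => hc J hJ fun y => Real.log (q J y)

theorem vcDim_kFactorDists_upper_bound {n : ℕ} (hn : 1 ≤ n) (Ωi : Fin n → Type*)
    [∀ i, Fintype (Ωi i)] [∀ i, Nonempty (Ωi i)]
    (m : Fin n → ℕ) (hm : ∀ i, m i = Fintype.card (Ωi i))
    (k : ℕ) (hk1 : 1 ≤ k) (hkn : k ≤ n)
    (hk : ℕ) (hhk : hk = ∑ J ∈ Finset.univ.powersetCard k, ∏ i ∈ J, m i) :
    (∀ T : Finset (∀ i, Ωi i), T.card = hk + 1 →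
        ¬ ShattersFam (thresholdFam (kFactorDists Ωi k)) T) ∧
      vcDim (thresholdFam (kFactorDists Ωi k)) ≤ (hk : ℕ∞) := by
  simp only [hm] at hhk
  subst hhk
  refine ⟨fun T hT => not_shattersFam_kFactorDists Ωi hkn T (by omega), iSup₂_le fun T hT => ?_⟩
  by_contra hlt
  exact not_shattersFam_kFactorDists Ωi hkn T (by exact_mod_cast not_le.mp hlt) hT
end

section
/- Let P be any probability distribution on Ω (the data-generating distribution), 1 ≤ k ≤ n, λ ∈ (0,1), l ≥ 1 an integer, and η ∈ (0,1). Then with probability at least 1 − η over i.i.d. samples x₁, …, x_l drawn from P (with respect to the l-fold product measure on Ω^l), simultaneously for every P_t ∈ H_k^λ: −Σ_{x∈Ω} P(x) ln P_t(x) ≤ −(1/l) Σ_{i=1}^l ln P_t(x_i) + φ(k, λ, η), where φ(k, λ, η) = (−ln λ)·√((h_k − ln h_k + ln 16 + ln l − ln η)/l). -/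
open Finset MeasureTheory

open ProbabilityTheory in
/-- Hoeffding's lemma for a random variable with values in `[a, a + c]`. -/
theorem integral_exp_mul_sub_le_of_mem_Icc {α : Type*} [MeasurableSpace α] (μ : Measure α)
    [IsProbabilityMeasure μ] {X : α → ℝ} (hX : Measurable X) {a : ℝ} {c : NNReal}
    (h : ∀ x, X x ∈ Set.Icc a (a + c)) (s : ℝ) :
    ∫ x, Real.exp (s * (X x - ∫ y, X y ∂μ)) ∂μ ≤ Real.exp ((c / 2 : ℝ) ^ 2 * s ^ 2 / 2) := by
  have := (hasSubgaussianMGF_of_mem_Icc (μ := μ) hX.aemeasurable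
    (Filter.Eventually.of_forall h)).mgf_le s
  simpa [mgf] using this

/-- The exponential moment bound behind McDiarmid's bounded-differences inequality. -/
theorem integral_exp_mul_sub_le_of_bounded_differences {α : Type*} [Finite α] [MeasurableSpace α]
    [MeasurableSingletonClass α] (μ : Measure α) [IsProbabilityMeasure μ] (c : NNReal) (s : ℝ)
    (l : ℕ) (F : (Fin l → α) → ℝ) (hF : ∀ xs i x, F (Function.update xs i x) ≤ F xs + c) :
    ∫ xs, Real.exp (s * (F xs - ∫ ys, F ys ∂Measure.pi fun _ => μ)) ∂(Measure.pi fun _ => μ) ≤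
      Real.exp (l * (c / 2 : ℝ) ^ 2 * s ^ 2 / 2) := by
  induction l with
  | zero => simp [integral_unique]
  | succ l ih =>
    have hne : Nonempty α := μ.nonempty_of_neZero
    set G : (Fin l → α) → ℝ := fun xs => ∫ x, F (Fin.cons x xs) ∂μ with hG
    have hsplit (H : (Fin (l + 1) → α) → ℝ) : ∫ xs, H xs ∂(Measure.pi fun _ => μ) =
        ∫ xs, ∫ x, H (Fin.cons x xs) ∂μ ∂(Measure.pi fun _ : Fin l => μ) := by
      rw [← ((measurePreserving_piFinSuccAbove (fun _ : Fin (l + 1) => μ) 0).symm).integral_comp',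
        integral_prod_symm _ Integrable.of_finite]
      simp_rw [MeasurableEquiv.piFinSuccAbove_symm_apply, Fin.insertNthEquiv, Equiv.coe_fn_mk,
        Fin.insertNth_zero]
      rfl
    have hGc : ∀ xs i x, G (Function.update xs i x) ≤ G xs + c := by
      intro xs i x
      have : G xs + c = ∫ y, (F (Fin.cons y xs) + c) ∂μ := by
        rw [integral_add Integrable.of_finite Integrable.of_finite]; simp [hG]
      rw [this]
      refine integral_mono Integrable.of_finite Integrable.of_finite fun y => ?_
      simpa only [Fin.cons_update] using hF (Fin.cons y xs) i.succ x
    have hinner (xs : Fin l → α) : ∫ x, Real.exp (s * (F (Fin.cons x xs) - G xs)) ∂μ ≤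
        Real.exp ((c / 2 : ℝ) ^ 2 * s ^ 2 / 2) := by
      refine integral_exp_mul_sub_le_of_mem_Icc μ (X := fun x => F (Fin.cons x xs))
        (a := ⨅ x, F (Fin.cons x xs)) Measurable.of_discrete (fun x => ⟨?_, ?_⟩) s
      · exact ciInf_le (Set.finite_range _).bddBelow x
      · rw [← sub_le_iff_le_add]
        refine le_ciInf fun y => ?_
        have := hF (Fin.cons y xs) 0 x
        rw [Fin.update_cons_zero] at this
        linarith
    rw [hsplit, hsplit F]
    calc _ = ∫ xs, (∫ x, Real.exp (s * (F (Fin.cons x xs) - G xs)) ∂μ) *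
          Real.exp (s * (G xs - ∫ ys, G ys ∂Measure.pi fun _ => μ)) ∂(Measure.pi fun _ => μ) := by
          refine integral_congr_ae (Filter.Eventually.of_forall fun xs => ?_)
          simp only
          rw [← integral_mul_const]
          refine integral_congr_ae (Filter.Eventually.of_forall fun x => ?_)
          simp only
          rw [← Real.exp_add]
          ring_nf
          rfl
      _ ≤ ∫ xs, Real.exp ((c / 2 : ℝ) ^ 2 * s ^ 2 / 2) *
          Real.exp (s * (G xs - ∫ ys, G ys ∂Measure.pi fun _ => μ)) ∂(Measure.pi fun _ => μ) :=
          integral_mono Integrable.of_finite Integrable.of_finite fun xs =>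
            mul_le_mul_of_nonneg_right (hinner xs) (Real.exp_nonneg _)
      _ ≤ Real.exp ((c / 2 : ℝ) ^ 2 * s ^ 2 / 2) * Real.exp (l * (c / 2 : ℝ) ^ 2 * s ^ 2 / 2) := by
          rw [integral_const_mul]
          exact mul_le_mul_of_nonneg_left (ih G hGc) (Real.exp_nonneg _)
      _ = _ := by
          rw [← Real.exp_add]
          push_cast
          ring_nf

open ProbabilityTheory in
/-- **McDiarmid's inequality** for i.i.d. samples from a finite space. -/
theorem measureReal_ge_le_of_bounded_differences {α : Type*} [Finite α] [MeasurableSpace α]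
    [MeasurableSingletonClass α] (μ : Measure α) [IsProbabilityMeasure μ] (c : NNReal)
    (l : ℕ) (F : (Fin l → α) → ℝ) (hF : ∀ xs i x, F (Function.update xs i x) ≤ F xs + c)
    {r : ℝ} (hr : 0 ≤ r) :
    (Measure.pi fun _ => μ).real {xs | r ≤ F xs - ∫ ys, F ys ∂Measure.pi fun _ => μ} ≤
      Real.exp (-r ^ 2 / (2 * (l * (c / 2 : ℝ) ^ 2))) := by
  have h : HasSubgaussianMGF (fun xs => F xs - ∫ ys, F ys ∂Measure.pi fun _ => μ)
      (l * (c / 2) ^ 2) (Measure.pi fun _ => μ) :=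
    { integrable_exp_mul := fun _ => Integrable.of_finite
      mgf_le := fun s => by
        simpa [mgf] using integral_exp_mul_sub_le_of_bounded_differences μ c s l F hF }
  simpa using h.measure_ge_le hr

open ProbabilityTheory in
/-- The empirical mean of `l` i.i.d. samples has mean squared error at most `𝔼[g ^ 2] / l`. -/
theorem integral_sq_empirical_sub_le {α : Type*} [Finite α] [MeasurableSpace α]
    [MeasurableSingletonClass α] (μ : Measure α) [IsProbabilityMeasure μ] {l : ℕ} (hl : 1 ≤ l)
    (g : α → ℝ) :
    ∫ xs, ((∫ x, g x ∂μ) - 1 / (l : ℝ) * ∑ i, g (xs i)) ^ 2 ∂(Measure.pi fun _ : Fin l => μ) ≤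
      (∫ x, g x ^ 2 ∂μ) / l := by
  have hl0 : (l : ℝ) ≠ 0 := by positivity
  have hLp : MemLp g 2 μ := MemLp.of_discrete
  have hmean : ∫ xs, (∑ i, fun xs : Fin l → α => g (xs i)) xs ∂(Measure.pi fun _ => μ) =
      l * ∫ x, g x ∂μ := by
    simp only [Finset.sum_apply]
    rw [integral_finsetSum _ fun _ _ => Integrable.of_finite]
    have (i : Fin l) : ∫ xs : Fin l → α, g (xs i) ∂(Measure.pi fun _ => μ) = ∫ x, g x ∂μ :=
      integral_comp_eval (μ := fun _ => μ) (f := g) hLp.aestronglyMeasurable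
    simp [this]
  have hvar := variance_sum_pi (μ := fun _ : Fin l => μ) (X := fun _ => g) fun _ => hLp
  rw [variance_eq_integral Measurable.of_discrete.aemeasurable, hmean] at hvar
  have hrw (xs : Fin l → α) : ((∫ x, g x ∂μ) - 1 / (l : ℝ) * ∑ i, g (xs i)) ^ 2 =
      ((∑ i, fun xs : Fin l → α => g (xs i)) xs - l * ∫ x, g x ∂μ) ^ 2 * (1 / (l : ℝ) ^ 2) := by
    simp only [Finset.sum_apply]
    field_simp
    ring
  simp_rw [hrw]
  rw [integral_mul_const, hvar, Finset.sum_const, Finset.card_univ, Fintype.card_fin, nsmul_eq_mul]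
  have hle : Var[g; μ] ≤ ∫ x, g x ^ 2 ∂μ := by
    simpa using variance_le_expectation_sq hLp.aestronglyMeasurable
  calc _ = Var[g; μ] / l := by field_simp
    _ ≤ _ := by gcongr

/-- Over a finite-dimensional space `V` of functions, the squared deviation of the empirical mean is
bounded by the second moment times a random factor of expectation at most `dim V / l`. -/
theorem exists_sq_empirical_sub_le_of_mem {α : Type*} [Fintype α] [MeasurableSpace α]
    [MeasurableSingletonClass α] (μ : Measure α) [IsProbabilityMeasure μ] {l : ℕ} (hl : 1 ≤ l)
    (V : Submodule ℝ (α → ℝ)) :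
    ∃ Q : (Fin l → α) → ℝ, (∀ xs, 0 ≤ Q xs) ∧
      ∫ xs, Q xs ∂(Measure.pi fun _ => μ) ≤ Module.finrank ℝ V / (l : ℝ) ∧
      ∀ᵐ xs ∂(Measure.pi fun _ => μ), ∀ f ∈ V,
        ((∫ x, f x ∂μ) - 1 / (l : ℝ) * ∑ i, f (xs i)) ^ 2 ≤ (∫ x, f x ^ 2 ∂μ) * Q xs := by
  set w : α → ℝ := fun x => √(μ.real {x})
  have hw2 (x : α) : w x ^ 2 = μ.real {x} := Real.sq_sqrt measureReal_nonneg
  let T : (α → ℝ) →ₗ[ℝ] EuclideanSpace ℝ α :=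
    { toFun := fun f => WithLp.toLp 2 fun x => w x * f x
      map_add' := fun f g => by ext x; simp [mul_add]
      map_smul' := fun a f => by ext x; simp; ring }
  let b := stdOrthonormalBasis ℝ (V.map T)
  let φ := fun j x => (b j : EuclideanSpace ℝ α) x / w x
  have hsupp : ∀ᵐ x ∂μ, w x ≠ 0 := by
    rw [ae_iff_of_countable]
    intro x hx h
    have : μ.real {x} = 0 := by rw [← hw2, h]; simp
    exact hx ((measureReal_eq_zero_iff).1 this)
  have hφ (j) : ∫ x, φ j x ^ 2 ∂μ ≤ 1 := by
    have hnorm : ‖(b j : EuclideanSpace ℝ α)‖ ^ 2 = 1 := by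
      have := b.orthonormal.1 j
      rw [Submodule.norm_coe, this, one_pow]
    rw [← hnorm, EuclideanSpace.norm_sq_eq, integral_fintype Integrable.of_finite]
    refine Finset.sum_le_sum fun x _ => ?_
    rw [← hw2, smul_eq_mul, Real.norm_eq_abs, sq_abs]
    by_cases h : w x = 0
    · simpa [h] using sq_nonneg _
    · simp only [φ]; field_simp; rfl
  refine ⟨fun xs => ∑ j, ((∫ x, φ j x ∂μ) - 1 / (l : ℝ) * ∑ i, φ j (xs i)) ^ 2,
    fun xs => Finset.sum_nonneg fun _ _ => sq_nonneg _, ?_, ?_⟩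
  · rw [integral_finsetSum _ fun _ _ => Integrable.of_finite]
    calc _ ≤ ∑ _j : Fin (Module.finrank ℝ (V.map T)), 1 / (l : ℝ) := by
          refine Finset.sum_le_sum fun j _ => (integral_sq_empirical_sub_le μ hl (φ j)).trans ?_
          gcongr
          exact hφ j
      _ = Module.finrank ℝ (V.map T) / (l : ℝ) := by simp [div_eq_mul_inv]
      _ ≤ _ := by
          gcongr
          exact Submodule.finrank_map_le T V
  · have hsupp' : ∀ᵐ xs ∂(Measure.pi fun _ : Fin l => μ), ∀ i, w (xs i) ≠ 0 :=
      ae_all_iff.2 fun i =>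
        (measurePreserving_eval (fun _ : Fin l => μ) i).quasiMeasurePreserving.ae hsupp
    filter_upwards [hsupp'] with xs hxs f hf
    set v : V.map T := ⟨T f, Submodule.mem_map_of_mem hf⟩
    set a := fun j => inner ℝ (b j) v with ha
    have hexp (x : α) (hx : w x ≠ 0) : f x = ∑ j, a j * φ j x := by
      have h1 : (v : EuclideanSpace ℝ α) x = ∑ j, a j * (b j : EuclideanSpace ℝ α) x := by
        conv_lhs => rw [← b.sum_repr' v]
        simp [ha]
      have h2 : (v : EuclideanSpace ℝ α) x = w x * f x := rfl
      rw [h2] at h1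
      simp only [φ, mul_div_assoc', ← Finset.sum_div, ← h1]
      field_simp
    have hint : ∫ x, f x ∂μ = ∑ j, a j * ∫ x, φ j x ∂μ := by
      rw [integral_congr_ae (hsupp.mono hexp),
        integral_finsetSum _ fun _ _ => Integrable.of_finite]
      simp_rw [integral_const_mul]
    have hemp : 1 / (l : ℝ) * ∑ i, f (xs i) = ∑ j, a j * (1 / (l : ℝ) * ∑ i, φ j (xs i)) := by
      rw [Finset.sum_congr rfl fun i _ => hexp (xs i) (hxs i), Finset.sum_comm, Finset.mul_sum]
      refine Finset.sum_congr rfl fun j _ => ?_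
      rw [← Finset.mul_sum]; ring
    have hnorm : ∑ j, a j ^ 2 = ∫ x, f x ^ 2 ∂μ := by
      have h1 : ∑ j, a j ^ 2 = ‖v‖ ^ 2 := by
        rw [← b.sum_sq_norm_inner_right v]
        simp [ha]
      rw [h1, ← Submodule.norm_coe, EuclideanSpace.norm_sq_eq,
        integral_fintype Integrable.of_finite]
      refine Finset.sum_congr rfl fun x _ => ?_
      have h2 : (v : EuclideanSpace ℝ α) x = w x * f x := rfl
      rw [h2, Real.norm_eq_abs, sq_abs, mul_pow, hw2, smul_eq_mul]
    rw [hint, hemp, ← Finset.sum_sub_distrib, ← hnorm]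
    simp_rw [← mul_sub]
    exact Finset.sum_mul_sq_le_sq_mul_sq _ _ _

open ProbabilityTheory in
/-- Uniform one-sided deviation bound over the `[-B, 0]`-valued members of a finite-dimensional
space of functions containing the constants. -/
theorem one_sub_le_measure_forall_mem_empirical_le {α : Type*} [Fintype α] [MeasurableSpace α]
    [MeasurableSingletonClass α] (μ : Measure α) [IsProbabilityMeasure μ] {l : ℕ} (hl : 1 ≤ l)
    (V : Submodule ℝ (α → ℝ)) (hV : (fun _ => 1) ∈ V) {B : ℝ} (hB : 0 < B) {η : ℝ} (hη0 : 0 < η)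
    (hη1 : η < 1) :
    ENNReal.ofReal (1 - η) ≤ (Measure.pi fun _ : Fin l => μ)
      {xs | ∀ f ∈ V, (∀ x, f x ∈ Set.Icc (-B) 0) →
        1 / (l : ℝ) * ∑ i, f (xs i) - ∫ x, f x ∂μ ≤
          B * √((Module.finrank ℝ V / 2 - Real.log η) / l)} := by
  have hl0 : (0 : ℝ) < l := by exact_mod_cast hl
  obtain ⟨Q, hQ0, hQ, hQV⟩ := exists_sq_empirical_sub_le_of_mem μ hl V
  set d : ℝ := (Module.finrank ℝ V : ℝ)
  set t : ℝ := -Real.log η with ht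
  have ht0 : 0 < t := neg_pos.2 (Real.log_neg hη0 hη1)
  let S := {f : α → ℝ // f ∈ V ∧ ∀ x, f x ∈ Set.Icc (-B) 0}
  have hS : Nonempty S := ⟨⟨0, V.zero_mem, fun x => ⟨by simpa using hB.le, le_rfl⟩⟩⟩
  let D : S → (Fin l → α) → ℝ := fun f xs => 1 / (l : ℝ) * ∑ i, f.1 (xs i) - ∫ x, f.1 x ∂μ
  have hbdd (xs : Fin l → α) : BddAbove (Set.range fun f => D f xs) := by
    refine ⟨B, ?_⟩
    rintro _ ⟨f, rfl⟩
    have h1 : 1 / (l : ℝ) * ∑ i, f.1 (xs i) ≤ 0 :=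
      mul_nonpos_of_nonneg_of_nonpos (by positivity) (Finset.sum_nonpos fun i _ => (f.2.2 _).2)
    have h2 : ∫ _x, -B ∂μ ≤ ∫ x, f.1 x ∂μ :=
      integral_mono Integrable.of_finite Integrable.of_finite fun x => (f.2.2 x).1
    simp only [integral_const, probReal_univ, one_smul] at h2
    simp only [D]
    linarith
  set Z : (Fin l → α) → ℝ := fun xs => ⨆ f, D f xs
  have hdiff : ∀ xs i x, Z (Function.update xs i x) ≤ Z xs + (B / l).toNNReal := by
    intro xs i x
    refine ciSup_le fun f => ?_
    have h1 : D f xs ≤ Z xs := le_ciSup (hbdd xs) f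
    have h2 : ∑ j, f.1 (Function.update xs i x j) ≤ ∑ j, f.1 (xs j) + B := by
      have h3 : ∑ j, (f.1 (Function.update xs i x j) - f.1 (xs j)) ≤
          ∑ j, if j = i then B else 0 := by
        refine Finset.sum_le_sum fun j _ => ?_
        by_cases hj : j = i
        · subst hj
          simp only [Function.update_self, if_true]
          linarith [(f.2.2 x).2, (f.2.2 (xs j)).1]
        · simp [hj]
      simp only [Finset.sum_sub_distrib, Finset.sum_ite_eq', Finset.mem_univ, if_true] at h3
      linarith
    have h3 : 1 / (l : ℝ) * ∑ j, f.1 (Function.update xs i x j) ≤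
        1 / (l : ℝ) * ∑ j, f.1 (xs j) + B / l := by
      calc _ ≤ 1 / (l : ℝ) * (∑ j, f.1 (xs j) + B) := by gcongr
        _ = _ := by ring
    simp only [D] at h1 ⊢
    rw [Real.coe_toNNReal _ (by positivity)]
    linarith
  have hmean : ∫ xs, Z xs ∂(Measure.pi fun _ => μ) ≤ B / 2 * √(d / l) := by
    have hZQ : ∀ᵐ xs ∂(Measure.pi fun _ : Fin l => μ), Z xs ≤ B / 2 * √(Q xs) := by
      filter_upwards [hQV] with xs hxs
      refine ciSup_le fun f => ?_
      have h1 := hxs (f.1 + (B / 2) • fun _ => 1) (V.add_mem f.2.1 (V.smul_mem _ hV))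
      simp only [Pi.add_apply, Pi.smul_apply, smul_eq_mul, mul_one] at h1
      rw [integral_add Integrable.of_finite Integrable.of_finite, Finset.sum_add_distrib] at h1
      simp only [integral_const, probReal_univ, one_smul, Finset.sum_const, Finset.card_univ,
        Fintype.card_fin, nsmul_eq_mul] at h1
      have h2 : ∫ x, (f.1 x + B / 2) ^ 2 ∂μ ≤ (B / 2) ^ 2 := by
        have : ∫ x, (f.1 x + B / 2) ^ 2 ∂μ ≤ ∫ _x, (B / 2) ^ 2 ∂μ :=
          integral_mono Integrable.of_finite Integrable.of_finite fun x =>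
            sq_le_sq' (by linarith [(f.2.2 x).1]) (by linarith [(f.2.2 x).2])
        simpa using this
      have h3 : D f xs ^ 2 ≤ (B / 2) ^ 2 * Q xs := by
        refine le_trans (le_of_eq ?_) (h1.trans (mul_le_mul_of_nonneg_right h2 (hQ0 xs)))
        simp only [D]
        field_simp
        ring
      have h4 := (le_abs_self _).trans (Real.abs_le_sqrt h3)
      rwa [Real.sqrt_mul (sq_nonneg _), Real.sqrt_sq (by positivity)] at h4
    have hsqrt : ∫ xs, √(Q xs) ∂(Measure.pi fun _ => μ) ≤ √(d / l) := by
      have h1 := variance_nonneg (fun xs => √(Q xs)) (Measure.pi fun _ => μ)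
      rw [variance_eq_sub MemLp.of_discrete] at h1
      simp only [Pi.pow_apply, Real.sq_sqrt (hQ0 _)] at h1
      exact Real.le_sqrt_of_sq_le (by linarith)
    calc _ ≤ ∫ xs, B / 2 * √(Q xs) ∂(Measure.pi fun _ => μ) :=
          integral_mono_ae Integrable.of_finite Integrable.of_finite hZQ
      _ ≤ _ := by
          rw [integral_const_mul]
          gcongr
  set r : ℝ := B * √(t / (2 * l)) with hr
  have hr0 : 0 < r := by positivity
  have htail := measureReal_ge_le_of_bounded_differences μ _ l Z hdiff hr0.le
  have hexp : -r ^ 2 / (2 * (l * (B / l / 2) ^ 2)) = Real.log η := by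
    rw [hr, mul_pow, Real.sq_sqrt (by positivity), ht]
    field_simp
  rw [Real.coe_toNNReal _ (by positivity), hexp, Real.exp_log hη0] at htail
  have hsum : B / 2 * √(d / l) + r ≤ B * √((d / 2 + t) / l) := by
    have hd0 : 0 ≤ d := Nat.cast_nonneg _
    have h1 : √(d / l) / 2 + √(t / (2 * l)) ≤ √((d / 2 + t) / l) := by
      apply Real.le_sqrt_of_sq_le
      have e1 : √(d / l) ^ 2 = d / l := Real.sq_sqrt (by positivity)
      have e2 : √(t / (2 * l)) ^ 2 = t / (2 * l) := Real.sq_sqrt (by positivity)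
      have e3 : (d / 2 + t) / l = 2 * ((d / l) / 4 + t / (2 * l)) := by field_simp; ring
      rw [e3]
      nlinarith [sq_nonneg (√(d / l) / 2 - √(t / (2 * l)))]
    calc _ = B * (√(d / l) / 2 + √(t / (2 * l))) := by rw [hr]; ring
      _ ≤ _ := by gcongr
  set E := {xs | r ≤ Z xs - ∫ ys, Z ys ∂Measure.pi fun _ => μ} with hE
  have hcompl : 1 - η ≤ (Measure.pi fun _ => μ).real Eᶜ := by
    rw [probReal_compl_eq_one_sub (Set.toFinite _).measurableSet]
    linarith
  refine le_trans (ENNReal.ofReal_le_of_le_toReal hcompl) (measure_mono fun xs hxs f hf hfB => ?_)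
  have h1 : D ⟨f, hf, hfB⟩ xs ≤ Z xs := le_ciSup (hbdd xs) _
  simp only [hE, Set.mem_compl_iff, Set.mem_ofPred_eq, not_le] at hxs
  simp only [D] at h1
  rw [sub_eq_add_neg (d / 2)]
  linarith

/-- The functions on `Π i, Ωi i` that are sums of functions of `k` coordinates each. -/
def kInteractionSpace {n : ℕ} (Ωi : Fin n → Type*) (k : ℕ) : Submodule ℝ ((∀ i, Ωi i) → ℝ) :=
  LinearMap.range
    (∑ J : (Finset.univ : Finset (Fin n)).powersetCard k,
      LinearMap.funLeft ℝ ℝ fun x : ∀ i, Ωi i =>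
        (⟨J, fun i => x i⟩ : Σ J : (Finset.univ : Finset (Fin n)).powersetCard k,
          ∀ i : J.1, Ωi i))

theorem sum_mem_kInteractionSpace {n : ℕ} (Ωi : Fin n → Type*) (k : ℕ)
    (g : (J : Finset (Fin n)) → ((i : J) → Ωi i) → ℝ) :
    (fun x => ∑ J ∈ Finset.univ.powersetCard k, g J fun i => x i) ∈ kInteractionSpace Ωi k := by
  refine ⟨fun p => g p.1 p.2, ?_⟩
  ext x
  simp only [LinearMap.sum_apply, Finset.sum_apply, LinearMap.funLeft_apply]
  exact Finset.sum_coe_sort (Finset.univ.powersetCard k) fun J => g J fun i => x i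

theorem one_mem_kInteractionSpace {n : ℕ} (Ωi : Fin n → Type*) {k : ℕ} (hkn : k ≤ n) :
    (fun _ => 1) ∈ kInteractionSpace Ωi k := by
  have h := sum_mem_kInteractionSpace Ωi k fun _ _ => ((n.choose k : ℝ))⁻¹
  have h0 : (n.choose k : ℝ) ≠ 0 := by exact_mod_cast (Nat.choose_pos hkn).ne'
  simpa [h0] using h

theorem finrank_kInteractionSpace_le {n : ℕ} (Ωi : Fin n → Type*) [∀ i, Fintype (Ωi i)] (k : ℕ) :
    Module.finrank ℝ (kInteractionSpace Ωi k) ≤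
      ∑ J ∈ Finset.univ.powersetCard k, ∏ i ∈ J, Fintype.card (Ωi i) := by
  refine (LinearMap.finrank_range_le _).trans (le_of_eq ?_)
  rw [Module.finrank_fintype_fun_eq_card, Fintype.card_sigma,
    ← Finset.sum_coe_sort (Finset.univ.powersetCard k)]
  refine Finset.sum_congr rfl fun J _ => ?_
  rw [Fintype.card_pi]
  exact Finset.prod_coe_sort J.1 fun i => Fintype.card (Ωi i)

theorem log_mem_kInteractionSpace {n : ℕ} {Ωi : Fin n → Type*} [∀ i, Fintype (Ωi i)] {k : ℕ}
    {P : (∀ i, Ωi i) → ℝ} (hP : P ∈ kFactorDists Ωi k) :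
    (fun x => Real.log (P x)) ∈ kInteractionSpace Ωi k := by
  obtain ⟨-, q, hq, hPq⟩ := hP
  convert sum_mem_kInteractionSpace Ωi k fun J y => Real.log (q J y) using 2 with x
  rw [hPq, Real.log_prod fun J _ => (hq J _).ne']

/-- Risk bound for the model class `H_k^λ` of `k`-factor distributions bounded below
by `λ`: with probability at least `1 - η` over i.i.d. samples from `P`, simultaneously
for all `P_t ∈ H_k^λ`, the risk is bounded by the empirical risk plus
`φ(k, λ, η) = (-ln λ) √((h_k - ln h_k + ln 16 + ln l - ln η)/l)`. -/
theorem risk_bound_kFactor {n : ℕ} (hn : 1 ≤ n) (Ωi : Fin n → Type*)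
    [∀ i, Fintype (Ωi i)] [∀ i, Nonempty (Ωi i)]
    [MeasurableSpace (∀ i, Ωi i)] [MeasurableSingletonClass (∀ i, Ωi i)]
    (μ : Measure (∀ i, Ωi i)) [IsProbabilityMeasure μ]
    (P : (∀ i, Ωi i) → ℝ) (hP : ∀ x, P x = (μ {x}).toReal)
    (m : Fin n → ℕ) (hm : ∀ i, m i = Fintype.card (Ωi i))
    (k : ℕ) (hk1 : 1 ≤ k) (hkn : k ≤ n)
    (lam : ℝ) (hlam0 : 0 < lam) (hlam1 : lam < 1)
    (l : ℕ) (hl : 1 ≤ l) (η : ℝ) (hη0 : 0 < η) (hη1 : η < 1)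
    (hk : ℝ) (hhk : hk = ∑ J ∈ Finset.univ.powersetCard k, ∏ i ∈ J, (m i : ℝ)) :
    ENNReal.ofReal (1 - η) ≤
      (Measure.pi fun _ : Fin l => μ)
        {xs | ∀ Pt ∈ kFactorDists Ωi k, (∀ x, lam ≤ Pt x) →
            -(∑ x, P x * Real.log (Pt x)) ≤
              -((1 / (l : ℝ)) * ∑ i, Real.log (Pt (xs i))) +
                (-Real.log lam) *
                  Real.sqrt ((hk - Real.log hk + Real.log 16 + Real.log l - Real.log η) / l)} := by
  have hB : 0 < -Real.log lam := neg_pos.2 (Real.log_neg hlam0 hlam1)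
  have hdim : (Module.finrank ℝ (kInteractionSpace Ωi k) : ℝ) ≤ hk := by
    rw [hhk]
    simp_rw [hm]
    exact_mod_cast finrank_kInteractionSpace_le Ωi k
  refine (one_sub_le_measure_forall_mem_empirical_le μ hl (kInteractionSpace Ωi k)
    (one_mem_kInteractionSpace Ωi hkn) hB hη0 hη1).trans
      (measure_mono fun xs hxs Pt hPt hlamPt => ?_)
  have hle1 (x) : Pt x ≤ 1 := by
    rw [← hPt.1]
    exact Finset.single_le_sum (fun y _ => hlam0.le.trans (hlamPt y)) (Finset.mem_univ x)
  have hdev := hxs _ (log_mem_kInteractionSpace hPt) fun x =>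
    ⟨by simpa using Real.log_le_log hlam0 (hlamPt x),
      Real.log_nonpos (hlam0.le.trans (hlamPt x)) (hle1 x)⟩
  have hint : ∫ x, Real.log (Pt x) ∂μ = ∑ x, P x * Real.log (Pt x) := by
    rw [integral_fintype Integrable.of_finite]
    simp_rw [hP, smul_eq_mul]
    rfl
  have hlog : Real.log hk ≤ hk / 2 := by
    rcases (((Nat.cast_nonneg _).trans hdim : (0 : ℝ) ≤ hk)).eq_or_lt with h | h
    · simp [← h]
    · have h1 := Real.log_le_sub_one_of_pos (half_pos h)
      rw [Real.log_div h.ne' two_ne_zero] at h1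
      linarith [Real.log_two_lt_d9]
  have hphi : √((Module.finrank ℝ (kInteractionSpace Ωi k) / 2 - Real.log η) / l) ≤
      √((hk - Real.log hk + Real.log 16 + Real.log l - Real.log η) / l) := by
    gcongr
    linarith [Real.log_nonneg (show (1 : ℝ) ≤ 16 by norm_num), Real.log_natCast_nonneg l]
  have := mul_le_mul_of_nonneg_left hphi hB.le
  rw [hint] at hdev
  linarith
end

section
/- Let P be any probability distribution on Ω, let (λ_n)_{n∈ℕ} be a strictly monotone decreasing sequence in (0,1) converging to zero, let ν be a strictly positive probability measure on ℕ × ℕ, and set A_{kn} = {1,…,k} × {1,…,n}. Let l ≥ 1 be an integer and η ∈ (0,1). Then with probability at least 1 − η over i.i.d. samples x₁, …, x_l drawn from P (with respect to the l-fold product measure on Ω^l), simultaneously for all k, n ≥ 1 and all P_t ∈ H_k^{λ_n}: −Σ_{x∈Ω} P(x) ln P_t(x) ≤ −(1/l) Σ_{i=1}^l ln P_t(x_i) + φ(k, λ_n, η·ν(A_{kn})), where φ(k, λ, η') = (−ln λ)·√((h_k − ln h_k + ln 16 + ln l − ln η')/l). -/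
open Finset MeasureTheory

section ProductWeights

variable {α : Type*} [Fintype α]

lemma sum_fin_succ_pi_eq {l : ℕ} (F : (Fin (l + 1) → α) → ℝ) :
    ∑ xs, F xs = ∑ a, ∑ ys : Fin l → α, F (Fin.cons a ys) := by
  rw [← (Fin.consEquiv fun _ : Fin (l + 1) => α).sum_comp, Fintype.sum_prod_type]
  rfl

/-- The mean of `F` over `l` independent samples with point weights `p`. -/
def iidMean (p : α → ℝ) {l : ℕ} (F : (Fin l → α) → ℝ) : ℝ :=
  ∑ xs, (∏ i, p (xs i)) * F xs

lemma iidMean_succ (p : α → ℝ) {l : ℕ} (F : (Fin (l + 1) → α) → ℝ) :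
    iidMean p F = ∑ a, p a * iidMean p fun ys : Fin l → α => F (Fin.cons a ys) := by
  simp [iidMean, sum_fin_succ_pi_eq, Fin.prod_univ_succ, Finset.mul_sum, mul_assoc]

lemma iidMean_zero (p : α → ℝ) (F : (Fin 0 → α) → ℝ) : iidMean p F = F default := by
  simp [iidMean]

lemma iidMean_add (p : α → ℝ) {l : ℕ} (F G : (Fin l → α) → ℝ) :
    iidMean p (fun xs => F xs + G xs) = iidMean p F + iidMean p G := by
  simp [iidMean, mul_add, Finset.sum_add_distrib]

lemma iidMean_const_mul (p : α → ℝ) {l : ℕ} (c : ℝ) (F : (Fin l → α) → ℝ) :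
    iidMean p (fun xs => c * F xs) = c * iidMean p F := by
  simp [iidMean, Finset.mul_sum, mul_left_comm]

lemma iidMean_finset_sum (p : α → ℝ) {l : ℕ} {ι : Type*} (s : Finset ι)
    (F : ι → (Fin l → α) → ℝ) :
    iidMean p (fun xs => ∑ j ∈ s, F j xs) = ∑ j ∈ s, iidMean p (F j) := by
  simp only [iidMean, Finset.mul_sum]
  exact Finset.sum_comm

lemma iidMean_const {p : α → ℝ} (hp1 : ∑ a, p a = 1) {l : ℕ} (c : ℝ) :
    iidMean p (fun _ : Fin l → α => c) = c := by
  induction l with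
  | zero => simp [iidMean_zero]
  | succ l ih => simp [iidMean_succ, ih, ← Finset.sum_mul, hp1]

lemma iidMean_mono {p : α → ℝ} (hp0 : ∀ a, 0 ≤ p a) {l : ℕ} {F G : (Fin l → α) → ℝ}
    (hFG : ∀ xs, (∀ i, p (xs i) ≠ 0) → F xs ≤ G xs) : iidMean p F ≤ iidMean p G := by
  refine Finset.sum_le_sum fun xs _ => ?_
  by_cases hxs : ∀ i, p (xs i) ≠ 0
  · exact mul_le_mul_of_nonneg_left (hFG xs hxs) (Finset.prod_nonneg fun i _ => hp0 _)
  · push Not at hxs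
    obtain ⟨i, hi⟩ := hxs
    have h0 : ∏ i, p (xs i) = 0 := Finset.prod_eq_zero (Finset.mem_univ i) hi
    simp [h0]

lemma sq_iidMean_le {p : α → ℝ} (hp0 : ∀ a, 0 ≤ p a) (hp1 : ∑ a, p a = 1) {l : ℕ}
    (F : (Fin l → α) → ℝ) : iidMean p F ^ 2 ≤ iidMean p fun xs => F xs ^ 2 := by
  set M := iidMean p F
  have h1 : iidMean p (fun xs => 2 * M * F xs + -M ^ 2) ≤ iidMean p fun xs => F xs ^ 2 :=
    iidMean_mono hp0 fun xs _ => by nlinarith [sq_nonneg (F xs - M)]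
  rw [iidMean_add, iidMean_const_mul, iidMean_const hp1] at h1
  change 2 * M * M + -M ^ 2 ≤ _ at h1
  linarith

lemma iidMean_sum_eq_zero {p : α → ℝ} (hp1 : ∑ a, p a = 1) {g : α → ℝ}
    (hg : ∑ a, p a * g a = 0) (l : ℕ) :
    iidMean p (fun xs : Fin l → α => ∑ i, g (xs i)) = 0 := by
  induction l with
  | zero => simp [iidMean_zero]
  | succ l ih => simp [iidMean_succ, Fin.sum_univ_succ, iidMean_add, iidMean_const hp1, ih, hg]

lemma iidMean_sum_sq {p : α → ℝ} (hp1 : ∑ a, p a = 1) {g : α → ℝ}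
    (hg : ∑ a, p a * g a = 0) (l : ℕ) :
    iidMean p (fun xs : Fin l → α => (∑ i, g (xs i)) ^ 2) = l * ∑ a, p a * g a ^ 2 := by
  induction l with
  | zero => simp [iidMean_zero]
  | succ l ih =>
    have hstep (a : α) : iidMean p (fun ys : Fin l → α => (g a + ∑ i, g (ys i)) ^ 2) =
        g a ^ 2 + l * ∑ a, p a * g a ^ 2 := by
      have : (fun ys : Fin l → α => (g a + ∑ i, g (ys i)) ^ 2) =
          fun ys => (g a ^ 2 + 2 * g a * ∑ i, g (ys i)) + (∑ i, g (ys i)) ^ 2 := by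
        funext ys; ring
      rw [this, iidMean_add, iidMean_add, iidMean_const hp1, iidMean_const_mul,
        iidMean_sum_eq_zero hp1 hg, ih]
      ring
    simp only [iidMean_succ, Fin.sum_univ_succ, Fin.cons_zero, Fin.cons_succ, hstep, mul_add,
      Finset.sum_add_distrib, ← Finset.sum_mul, hp1]
    push_cast
    ring

end ProductWeights

section McDiarmid

variable {α : Type*} [Fintype α] [MeasurableSpace α] [MeasurableSingletonClass α]
  (μ : Measure α) [IsProbabilityMeasure μ]

lemma sum_real_singleton : ∑ a, μ.real {a} = 1 := by
  simp

lemma sum_mul_exp_sub_mean_le [Nonempty α] {Y : α → ℝ} {c : ℝ} (hc : 0 ≤ c)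
    (hY : ∀ a b, Y a - Y b ≤ c) :
    ∑ a, μ.real {a} * Real.exp (Y a - ∑ b, μ.real {b} * Y b) ≤ Real.exp (c ^ 2 / 8) := by
  obtain ⟨a₀, ha₀⟩ := Finite.exists_min Y
  have hmem : ∀ᵐ a ∂μ, Y a ∈ Set.Icc (Y a₀) (Y a₀ + c) :=
    .of_forall fun a => ⟨ha₀ a, by linarith [hY a a₀]⟩
  have h := (ProbabilityTheory.hasSubgaussianMGF_of_mem_Icc
    (measurable_of_finite Y).aemeasurable hmem).mgf_le 1
  simp only [ProbabilityTheory.mgf, integral_fintype (Integrable.of_finite), smul_eq_mul,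
    one_mul] at h
  refine h.trans_eq ?_
  simp [abs_of_nonneg hc]
  ring

/-- McDiarmid's bound on the exponential moment of a function with bounded differences. -/
lemma iidMean_exp_sub_iidMean_le [Nonempty α] {c : ℝ} (hc : 0 ≤ c) {l : ℕ}
    (F : (Fin l → α) → ℝ) (hF : ∀ xs i a, F (Function.update xs i a) - F xs ≤ c) :
    iidMean (fun a => μ.real {a}) (fun xs => Real.exp (F xs - iidMean (fun a => μ.real {a}) F)) ≤
      Real.exp (l * c ^ 2 / 8) := by
  have hp0 : ∀ a, 0 ≤ μ.real {a} := fun _ => measureReal_nonneg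
  have hp1 := sum_real_singleton μ
  induction l with
  | zero => simp [iidMean_zero]
  | succ l ih =>
    set p := fun a => μ.real {a}
    set G : α → ℝ := fun a => iidMean p fun ys => F (Fin.cons a ys)
    have hM : iidMean p F = ∑ a, p a * G a := iidMean_succ p F
    have hGdiff (a b : α) : G a - G b ≤ c := by
      have : G a ≤ iidMean p fun ys => F (Fin.cons b ys) + c := iidMean_mono hp0 fun ys _ => by
        have := hF (Fin.cons b ys) 0 a
        rw [Fin.update_cons_zero] at this
        linarith
      rw [iidMean_add, iidMean_const hp1] at this
      linarith
    have hinner (a : α) : iidMean p (fun ys => Real.exp (F (Fin.cons a ys) - iidMean p F)) ≤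
        Real.exp (G a - iidMean p F) * Real.exp (l * c ^ 2 / 8) := by
      have h := ih (fun ys => F (Fin.cons a ys)) fun ys i b => by
        rw [Fin.cons_update]
        exact hF _ _ _
      calc _ = iidMean p fun ys => Real.exp (G a - iidMean p F) *
            Real.exp (F (Fin.cons a ys) - G a) := by
              congr 1; funext ys; rw [← Real.exp_add]; congr 1; ring
        _ = Real.exp (G a - iidMean p F) *
            iidMean p (fun ys => Real.exp (F (Fin.cons a ys) - G a)) := iidMean_const_mul ..
        _ ≤ _ := mul_le_mul_of_nonneg_left h (Real.exp_nonneg _)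
    rw [iidMean_succ]
    calc ∑ a, p a * iidMean p (fun ys => Real.exp (F (Fin.cons a ys) - iidMean p F))
      ≤ ∑ a, p a * (Real.exp (G a - iidMean p F) * Real.exp (l * c ^ 2 / 8)) :=
          Finset.sum_le_sum fun a _ => mul_le_mul_of_nonneg_left (hinner a) (hp0 a)
      _ = (∑ a, p a * Real.exp (G a - ∑ b, p b * G b)) * Real.exp (l * c ^ 2 / 8) := by
          simp [Finset.sum_mul, hM, mul_assoc]
      _ ≤ Real.exp (c ^ 2 / 8) * Real.exp (l * c ^ 2 / 8) :=
          mul_le_mul_of_nonneg_right (sum_mul_exp_sub_mean_le μ hc hGdiff) (Real.exp_nonneg _)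
      _ = _ := by rw [← Real.exp_add]; congr 1; push_cast; ring

lemma measureReal_pi_eq_iidMean_indicator {l : ℕ} (S : Set (Fin l → α)) :
    (Measure.pi fun _ : Fin l => μ).real S = iidMean (fun a => μ.real {a}) (S.indicator 1) := by
  classical
  rw [← integral_indicator_one S.toFinite.measurableSet,
    integral_fintype (Integrable.of_finite)]
  simp [iidMean, measureReal_def, Measure.pi_singleton, ENNReal.toReal_prod]

/-- McDiarmid's inequality on a finite sample space. -/
lemma measureReal_pi_gt_le_exp [Nonempty α] {l : ℕ} (hl : 1 ≤ l) (F : (Fin l → α) → ℝ)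
    (hF : ∀ xs i a, F (Function.update xs i a) - F xs ≤ 1 / l) {u : ℝ} (hu : 0 ≤ u) :
    (Measure.pi fun _ : Fin l => μ).real
        {xs | iidMean (fun a => μ.real {a}) F + u < F xs} ≤ Real.exp (-(2 * l * u ^ 2)) := by
  set p := fun a => μ.real {a}
  have hl0 : (0 : ℝ) < l := by exact_mod_cast hl
  have hp0 : ∀ a, 0 ≤ p a := fun _ => measureReal_nonneg
  set t : ℝ := 4 * l * u with ht
  have ht0 : 0 ≤ t := by positivity
  have hmgf := iidMean_exp_sub_iidMean_le μ (c := t / l) (by positivity) (fun xs => t * F xs)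
    fun xs i a => by
      have := mul_le_mul_of_nonneg_left (hF xs i a) ht0
      rw [mul_sub] at this
      exact this.trans_eq (by ring)
  rw [iidMean_const_mul] at hmgf
  set S := {xs | iidMean p F + u < F xs}
  rw [measureReal_pi_eq_iidMean_indicator]
  calc iidMean p (S.indicator 1)
      ≤ iidMean p (fun xs => Real.exp (-(t * u)) * Real.exp (t * F xs - t * iidMean p F)) := by
        refine iidMean_mono hp0 fun xs _ => ?_
        rw [← Real.exp_add]
        by_cases h : xs ∈ S
        · rw [Set.indicator_of_mem h, Pi.one_apply, Real.one_le_exp_iff]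
          have h' : iidMean p F + u < F xs := h
          nlinarith
        · rw [Set.indicator_of_notMem h]
          positivity
    _ ≤ Real.exp (-(t * u)) * Real.exp (l * (t / l) ^ 2 / 8) := by
        rw [iidMean_const_mul]
        exact mul_le_mul_of_nonneg_left hmgf (Real.exp_nonneg _)
    _ = _ := by
        rw [← Real.exp_add, ht]
        congr 1
        field_simp
        ring

end McDiarmid

section LinearClass

variable {α : Type*}

/-- The functions of the linear space `V` with values in `[-1/2, 1/2]`. -/
def halfBall (V : Submodule ℝ (α → ℝ)) : Set (α → ℝ) :=
  {f | f ∈ V ∧ ∀ a, |f a| ≤ 1 / 2}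

lemma zero_mem_halfBall (V : Submodule ℝ (α → ℝ)) : (0 : α → ℝ) ∈ halfBall V :=
  ⟨V.zero_mem, by simp⟩

variable [Fintype α]

/-- The empirical mean of `f` on the sample `xs` minus its mean under the weights `p`. -/
noncomputable def empiricalDeviation (p : α → ℝ) {l : ℕ} (f : α → ℝ) (xs : Fin l → α) : ℝ :=
  (1 / (l : ℝ)) * ∑ i, f (xs i) - ∑ a, p a * f a

/-- The largest deviation over the functions of `V` with values in `[-1/2, 1/2]`. -/
noncomputable def supDeviation (p : α → ℝ) (V : Submodule ℝ (α → ℝ)) {l : ℕ}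
    (xs : Fin l → α) : ℝ :=
  ⨆ f : halfBall V, empiricalDeviation p f.1 xs

lemma bddAbove_empiricalDeviation {p : α → ℝ} (hp0 : ∀ a, 0 ≤ p a) (V : Submodule ℝ (α → ℝ))
    {l : ℕ} (xs : Fin l → α) :
    BddAbove (Set.range fun f : halfBall V => empiricalDeviation p f.1 xs) := by
  refine ⟨(1 / (l : ℝ)) * ∑ _i : Fin l, 1 / 2 + ∑ a, p a * (1 / 2), ?_⟩
  rintro _ ⟨⟨f, -, hf⟩, rfl⟩
  simp only [empiricalDeviation, sub_eq_add_neg, ← Finset.sum_neg_distrib]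
  gcongr with i _ a _
  · exact (abs_le.1 (hf _)).2
  · rw [← mul_neg]
    exact mul_le_mul_of_nonneg_left (by linarith [(abs_le.1 (hf a)).1]) (hp0 a)

lemma empiricalDeviation_le_supDeviation {p : α → ℝ} (hp0 : ∀ a, 0 ≤ p a)
    {V : Submodule ℝ (α → ℝ)} {f : α → ℝ} (hf : f ∈ halfBall V) {l : ℕ} (xs : Fin l → α) :
    empiricalDeviation p f xs ≤ supDeviation p V xs :=
  le_ciSup (bddAbove_empiricalDeviation hp0 V xs) (⟨f, hf⟩ : halfBall V)

lemma supDeviation_le {p : α → ℝ} {V : Submodule ℝ (α → ℝ)} {l : ℕ} {xs : Fin l → α} {b : ℝ}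
    (hb : ∀ f ∈ halfBall V, empiricalDeviation p f xs ≤ b) : supDeviation p V xs ≤ b := by
  have : Nonempty (halfBall V) := ⟨⟨0, zero_mem_halfBall V⟩⟩
  exact ciSup_le fun f => hb f.1 f.2

lemma supDeviation_nonneg {p : α → ℝ} (hp0 : ∀ a, 0 ≤ p a) (V : Submodule ℝ (α → ℝ)) {l : ℕ}
    (xs : Fin l → α) : 0 ≤ supDeviation p V xs := by
  simpa [empiricalDeviation] using
    empiricalDeviation_le_supDeviation hp0 (zero_mem_halfBall V) xs

lemma supDeviation_update_sub_le {p : α → ℝ} (hp0 : ∀ a, 0 ≤ p a) (V : Submodule ℝ (α → ℝ))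
    {l : ℕ} (xs : Fin l → α) (i : Fin l) (a : α) :
    supDeviation p V (Function.update xs i a) - supDeviation p V xs ≤ 1 / l := by
  rw [sub_le_iff_le_add]
  refine supDeviation_le fun f hf => ?_
  have h1 := empiricalDeviation_le_supDeviation hp0 hf xs
  have h2 : ∑ j, f (Function.update xs i a j) ≤ 1 + ∑ j, f (xs j) := by
    rw [← Finset.add_sum_erase _ _ (Finset.mem_univ i),
      ← Finset.add_sum_erase _ (fun j => f (xs j)) (Finset.mem_univ i), Function.update_self,
      Finset.sum_congr rfl fun j hj => by rw [Function.update_of_ne (Finset.ne_of_mem_erase hj)]]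
    linarith [(abs_le.1 (hf.2 a)).2, (abs_le.1 (hf.2 (xs i))).1]
  have h3 : (1 / (l : ℝ)) * ∑ j, f (Function.update xs i a j) ≤
      (1 / (l : ℝ)) * (1 + ∑ j, f (xs j)) := mul_le_mul_of_nonneg_left h2 (by positivity)
  rw [empiricalDeviation] at h1 ⊢
  linarith

/-- An orthonormal system for `V` in the (possibly degenerate) space `L²(p)`. -/
lemma exists_weighted_orthonormal {p : α → ℝ} (hp0 : ∀ a, 0 ≤ p a) (V : Submodule ℝ (α → ℝ)) :
    ∃ (r : ℕ) (e : Fin r → α → ℝ), r ≤ Module.finrank ℝ V ∧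
      (∀ j, ∑ a, p a * e j a ^ 2 = 1) ∧
      ∀ f ∈ V, ∃ c : Fin r → ℝ, ∑ j, c j ^ 2 = ∑ a, p a * f a ^ 2 ∧
        ∀ a, p a ≠ 0 → f a = ∑ j, c j * e j a := by
  let S : (α → ℝ) →ₗ[ℝ] EuclideanSpace ℝ α :=
    { toFun := fun f => WithLp.toLp 2 fun a => √(p a) * f a
      map_add' := fun f g => by ext a; simp [mul_add]
      map_smul' := fun c f => by ext a; simp [mul_left_comm] }
  have hS (f : α → ℝ) (a : α) : S f a = √(p a) * f a := rfl
  have hnorm (f : α → ℝ) : ‖S f‖ ^ 2 = ∑ a, p a * f a ^ 2 := by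
    simp [EuclideanSpace.norm_sq_eq, hS, mul_pow, Real.sq_sqrt (hp0 _)]
  let W := V.map S
  let b := stdOrthonormalBasis ℝ W
  have hpre (j) : ∃ g, S g = (b j : EuclideanSpace ℝ α) := (b j).2.imp fun _ => And.right
  choose e heS using hpre
  refine ⟨_, e, Submodule.finrank_map_le S V, fun j => ?_, fun f hf => ?_⟩
  · rw [← hnorm, heS]
    have := b.orthonormal.1 j
    rw [← Submodule.coe_norm, this, one_pow]
  · let w : W := ⟨S f, Submodule.mem_map_of_mem hf⟩
    refine ⟨fun j => b.repr w j, ?_, fun a ha => ?_⟩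
    · have h1 := EuclideanSpace.norm_sq_eq (b.repr w)
      rw [b.repr.norm_map] at h1
      rw [← hnorm]
      simpa using h1.symm
    · have h1 := congrArg (fun v : W => (v : EuclideanSpace ℝ α) a) (b.sum_repr w)
      simp only [Submodule.coe_sum, Submodule.coe_smul, ← heS, w] at h1
      have hpa : √(p a) ≠ 0 := (Real.sqrt_pos.2 (lt_of_le_of_ne (hp0 a) ha.symm)).ne'
      apply mul_left_cancel₀ hpa
      rw [← hS f a, ← h1, Finset.mul_sum, WithLp.ofLp_sum, Finset.sum_apply]
      refine Finset.sum_congr rfl fun j _ => ?_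
      rw [PiLp.smul_apply, hS, smul_eq_mul, mul_left_comm]

lemma iidMean_empiricalDeviation_sq_le {p : α → ℝ} (hp1 : ∑ a, p a = 1) (e : α → ℝ) {l : ℕ}
    (hl : 1 ≤ l) :
    iidMean p (fun xs : Fin l → α => empiricalDeviation p e xs ^ 2) ≤
      (∑ a, p a * e a ^ 2) / l := by
  have hl0 : (0 : ℝ) < l := by exact_mod_cast hl
  set m := ∑ a, p a * e a with hm
  have hcent : ∑ a, p a * (e a - m) = 0 := by
    simp [mul_sub, Finset.sum_sub_distrib, ← Finset.sum_mul, hp1, hm]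
  have hvar : ∑ a, p a * (e a - m) ^ 2 = ∑ a, p a * e a ^ 2 - m ^ 2 := by
    have : ∀ a, p a * (e a - m) ^ 2 = p a * e a ^ 2 - 2 * m * (p a * e a) + m ^ 2 * p a :=
      fun a => by ring
    simp only [this, Finset.sum_add_distrib, Finset.sum_sub_distrib, ← Finset.mul_sum, hp1, ← hm]
    ring
  have hfun : (fun xs : Fin l → α => empiricalDeviation p e xs ^ 2) =
      fun xs => (1 / (l : ℝ)) ^ 2 * (∑ i, (e (xs i) - m)) ^ 2 := by
    funext xs
    rw [← mul_pow, empiricalDeviation, ← hm]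
    congr 1
    simp only [Finset.sum_sub_distrib, Finset.sum_const, Finset.card_univ, Fintype.card_fin,
      nsmul_eq_mul]
    field_simp
  rw [hfun, iidMean_const_mul, iidMean_sum_sq hp1 (g := fun a => e a - m) hcent, hvar,
    show (1 / (l : ℝ)) ^ 2 * (l * (∑ a, p a * e a ^ 2 - m ^ 2)) =
      (∑ a, p a * e a ^ 2 - m ^ 2) / l by field_simp]
  gcongr
  nlinarith [sq_nonneg m]

lemma iidMean_supDeviation_le {p : α → ℝ} (hp0 : ∀ a, 0 ≤ p a) (hp1 : ∑ a, p a = 1)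
    (V : Submodule ℝ (α → ℝ)) {l : ℕ} (hl : 1 ≤ l) :
    iidMean p (fun xs : Fin l → α => supDeviation p V xs) ≤ √(Module.finrank ℝ V / l) / 2 := by
  have hl0 : (0 : ℝ) < l := by exact_mod_cast hl
  obtain ⟨r, e, hr, he, hrep⟩ := exists_weighted_orthonormal hp0 V
  have hpt (xs : Fin l → α) (hxs : ∀ i, p (xs i) ≠ 0) :
      supDeviation p V xs ^ 2 ≤ (1 / 4) * ∑ j, empiricalDeviation p (e j) xs ^ 2 := by
    set D := ∑ j, empiricalDeviation p (e j) xs ^ 2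
    have hD : 0 ≤ D := Finset.sum_nonneg fun j _ => sq_nonneg _
    have hle : supDeviation p V xs ≤ √((1 / 4) * D) := by
      refine supDeviation_le fun f hf => ?_
      obtain ⟨c, hc, hfc⟩ := hrep f hf.1
      have hdev : empiricalDeviation p f xs = ∑ j, c j * empiricalDeviation p (e j) xs := by
        have h1 : ∑ i, f (xs i) = ∑ j, c j * ∑ i, e j (xs i) := by
          simp only [Finset.mul_sum]
          rw [Finset.sum_comm]
          exact Finset.sum_congr rfl fun i _ => hfc _ (hxs i)
        have h2 : ∑ a, p a * f a = ∑ j, c j * ∑ a, p a * e j a := by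
          simp only [Finset.mul_sum]
          rw [Finset.sum_comm]
          refine Finset.sum_congr rfl fun a _ => ?_
          by_cases ha : p a = 0
          · simp [ha]
          · rw [hfc a ha, Finset.mul_sum]
            exact Finset.sum_congr rfl fun j _ => by ring
        simp only [empiricalDeviation, h1, h2, mul_sub, Finset.sum_sub_distrib, Finset.mul_sum]
        congr 1
        exact Finset.sum_congr rfl fun j _ => Finset.sum_congr rfl fun i _ => by ring
      have hc4 : ∑ j, c j ^ 2 ≤ 1 / 4 := by
        rw [hc]
        calc ∑ a, p a * f a ^ 2 ≤ ∑ a, p a * (1 / 4) := by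
              refine Finset.sum_le_sum fun a _ => mul_le_mul_of_nonneg_left ?_ (hp0 a)
              have := abs_le.1 (hf.2 a)
              nlinarith
          _ = 1 / 4 := by rw [← Finset.sum_mul, hp1, one_mul]
      refine Real.le_sqrt_of_sq_le ?_
      rw [hdev]
      exact (Finset.sum_mul_sq_le_sq_mul_sq _ _ _).trans (mul_le_mul_of_nonneg_right hc4 hD)
    calc supDeviation p V xs ^ 2 ≤ √((1 / 4) * D) ^ 2 :=
          pow_le_pow_left₀ (supDeviation_nonneg hp0 V xs) hle 2
      _ = _ := Real.sq_sqrt (by positivity)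
  have hsq : iidMean p (fun xs : Fin l → α => supDeviation p V xs) ^ 2 ≤
      (1 / 4) * (Module.finrank ℝ V / l) := by
    calc _ ≤ _ := sq_iidMean_le hp0 hp1 _
      _ ≤ _ := iidMean_mono hp0 hpt
      _ = (1 / 4) * ∑ j, iidMean p (fun xs : Fin l → α => empiricalDeviation p (e j) xs ^ 2) := by
          rw [iidMean_const_mul, iidMean_finset_sum]
      _ ≤ (1 / 4) * ∑ _j : Fin r, 1 / (l : ℝ) := by
          gcongr with j
          exact (iidMean_empiricalDeviation_sq_le hp1 (e j) hl).trans_eq (by rw [he])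
      _ = (1 / 4) * (r / l) := by simp [div_eq_mul_inv]
      _ ≤ _ := by gcongr
  calc _ ≤ √((1 / 4) * (Module.finrank ℝ V / l)) := Real.le_sqrt_of_sq_le hsq
    _ = _ := by
      rw [Real.sqrt_mul (by norm_num), show (1 / 4 : ℝ) = (1 / 2) ^ 2 by norm_num,
        Real.sqrt_sq (by norm_num)]
      ring

/-- Tail bound for the largest deviation over a linear space of dimension at most `d`. -/
lemma measureReal_pi_lt_supDeviation_le [Nonempty α] [MeasurableSpace α]
    [MeasurableSingletonClass α] (μ : Measure α) [IsProbabilityMeasure μ]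
    (V : Submodule ℝ (α → ℝ)) {d : ℝ} (hd : (Module.finrank ℝ V : ℝ) ≤ d) {l : ℕ} (hl : 1 ≤ l)
    {R : ℝ} (hR : 0 ≤ R) :
    (Measure.pi fun _ : Fin l => μ).real
        {xs | √(R / l) < supDeviation (fun a => μ.real {a}) V xs} ≤ Real.exp (d / 2 - R) := by
  have hl0 : (0 : ℝ) < l := by exact_mod_cast hl
  have hp0 : ∀ a, 0 ≤ μ.real {a} := fun _ => measureReal_nonneg
  have hd0 : 0 ≤ d := le_trans (by positivity) hd
  set ε := √(R / l) with hε
  set s := √(d / l) with hs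
  have hε2 : l * ε ^ 2 = R := by rw [hε, Real.sq_sqrt (by positivity)]; field_simp
  have hs2 : l * s ^ 2 = d := by rw [hs, Real.sq_sqrt (by positivity)]; field_simp
  have hmean : iidMean (fun a => μ.real {a}) (fun xs : Fin l → α =>
      supDeviation (fun a => μ.real {a}) V xs) ≤ s / 2 :=
    (iidMean_supDeviation_le hp0 (sum_real_singleton μ) V hl).trans (by rw [hs]; gcongr)
  rcases le_or_gt (s / 2) ε with hsε | hsε
  · calc _ ≤ _ := measureReal_mono fun xs hxs => by
            have hxs' : ε < supDeviation (fun a => μ.real {a}) V xs := hxs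
            change _ + (ε - s / 2) < _
            linarith
      _ ≤ Real.exp (-(2 * l * (ε - s / 2) ^ 2)) :=
          measureReal_pi_gt_le_exp μ hl _
            (fun xs i a => supDeviation_update_sub_le hp0 V xs i a) (by linarith)
      _ ≤ _ := by
          rw [Real.exp_le_exp, ← hε2, ← hs2]
          nlinarith [mul_nonneg hl0.le (sq_nonneg (ε - s))]
  · refine measureReal_le_one.trans (Real.one_le_exp ?_)
    have : ε ^ 2 ≤ (s / 2) ^ 2 := pow_le_pow_left₀ (Real.sqrt_nonneg _) hsε.le 2
    rw [← hε2, ← hs2]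
    nlinarith [mul_le_mul_of_nonneg_left this hl0.le, mul_nonneg hl0.le (sq_nonneg s)]

end LinearClass

section KFactor

variable {n : ℕ} (Ωi : Fin n → Type*)

/-- The linear map sending a family of functions on the `k`-element coordinate subsets to the
sum of their pullbacks. -/
def kFactorSum (k : ℕ) :
    ((Σ J : (Finset.univ.powersetCard k : Finset (Finset (Fin n))), (i : J.1) → Ωi i) → ℝ)
      →ₗ[ℝ] ((∀ i, Ωi i) → ℝ) where
  toFun c x := ∑ J, c ⟨J, fun i => x i⟩
  map_add' c d := by ext x; simp [Finset.sum_add_distrib]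
  map_smul' r c := by ext x; simp [Finset.mul_sum]

lemma const_mem_range_kFactorSum {k : ℕ} (hkn : k ≤ n) (r : ℝ) :
    (fun _ => r) ∈ LinearMap.range (kFactorSum Ωi k) := by
  refine ⟨fun _ => r / (n.choose k : ℝ), ?_⟩
  have : (n.choose k : ℝ) ≠ 0 := by exact_mod_cast (Nat.choose_pos hkn).ne'
  ext x
  simp only [kFactorSum, LinearMap.coe_mk, AddHom.coe_mk, Finset.sum_const, Finset.card_univ,
    Fintype.card_coe, Finset.card_powersetCard, Fintype.card_fin, nsmul_eq_mul]
  field_simp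

variable [∀ i, Fintype (Ωi i)]

lemma finrank_range_kFactorSum_le (k : ℕ) :
    (Module.finrank ℝ (LinearMap.range (kFactorSum Ωi k)) : ℝ) ≤
      ∑ J ∈ (Finset.univ : Finset (Fin n)).powersetCard k,
        ∏ i ∈ J, (Fintype.card (Ωi i) : ℝ) := by
  classical
  have h1 := LinearMap.finrank_range_le (kFactorSum Ωi k)
  rw [Module.finrank_fintype_fun_eq_card, Fintype.card_sigma] at h1
  calc _ ≤ _ := Nat.cast_le.2 h1
    _ = ∑ J : (Finset.univ.powersetCard k : Finset (Finset (Fin n))),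
          ∏ i ∈ J.1, (Fintype.card (Ωi i) : ℝ) := by
        push_cast
        refine Finset.sum_congr rfl fun J _ => ?_
        rw [Fintype.card_pi]
        push_cast
        exact Finset.prod_coe_sort J.1 fun i => (Fintype.card (Ωi i) : ℝ)
    _ = _ := Finset.sum_coe_sort (Finset.univ.powersetCard k)
          fun J => ∏ i ∈ J, (Fintype.card (Ωi i) : ℝ)

variable {Ωi}

lemma log_mem_range_kFactorSum {k : ℕ} {Q : (∀ i, Ωi i) → ℝ} (hQ : Q ∈ kFactorDists Ωi k) :
    (fun x => Real.log (Q x)) ∈ LinearMap.range (kFactorSum Ωi k) := by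
  obtain ⟨-, q, hq0, hq⟩ := hQ
  refine ⟨fun Jy => Real.log (q Jy.1 Jy.2), ?_⟩
  ext x
  rw [hq, Real.log_prod fun J _ => (hq0 _ _).ne']
  exact Finset.sum_coe_sort (Finset.univ.powersetCard k)
    fun J => Real.log (q J fun i => x i)

lemma kFactorDists_pos {k : ℕ} {Q : (∀ i, Ωi i) → ℝ} (hQ : Q ∈ kFactorDists Ωi k)
    (x : ∀ i, Ωi i) : 0 < Q x := by
  obtain ⟨-, q, hq0, hq⟩ := hQ
  rw [hq]
  exact Finset.prod_pos fun J _ => hq0 _ _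

lemma kFactorDists_le_one {k : ℕ} {Q : (∀ i, Ωi i) → ℝ} (hQ : Q ∈ kFactorDists Ωi k)
    (x : ∀ i, Ωi i) : Q x ≤ 1 :=
  hQ.1 ▸ Finset.single_le_sum (fun y _ => (kFactorDists_pos hQ y).le) (Finset.mem_univ x)

lemma kFactorDists_eq_one_of_lt {k : ℕ} (hk : n < k) {Q : (∀ i, Ωi i) → ℝ}
    (hQ : Q ∈ kFactorDists Ωi k) (x : ∀ i, Ωi i) : Q x = 1 := by
  obtain ⟨-, q, -, hq⟩ := hQ
  rw [hq, Finset.powersetCard_eq_empty.2 (by simpa using hk), Finset.prod_empty]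

lemma choose_le_sum_prod_card [∀ i, Nonempty (Ωi i)] (k : ℕ) :
    (n.choose k : ℝ) ≤ ∑ J ∈ (Finset.univ : Finset (Fin n)).powersetCard k,
      ∏ i ∈ J, (Fintype.card (Ωi i) : ℝ) := by
  calc (n.choose k : ℝ) = ∑ _J ∈ (Finset.univ : Finset (Fin n)).powersetCard k, (1 : ℝ) := by
        simp
    _ ≤ _ := Finset.sum_le_sum fun J _ => Finset.one_le_prod fun i _ => by
        exact_mod_cast Fintype.card_pos

/-- The deviation of the log-likelihood of a `k`-factor distribution bounded below by `t` is
controlled by the largest deviation over the linear space of logarithms. -/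
lemma empiricalDeviation_log_le {p : (∀ i, Ωi i) → ℝ} (hp0 : ∀ x, 0 ≤ p x)
    (hp1 : ∑ x, p x = 1) {k : ℕ} (hkn : k ≤ n) {t : ℝ} (ht0 : 0 < t) (ht1 : t < 1)
    {Q : (∀ i, Ωi i) → ℝ} (hQ : Q ∈ kFactorDists Ωi k) (hQt : ∀ x, t ≤ Q x) {l : ℕ} (hl : 1 ≤ l)
    (xs : Fin l → ∀ i, Ωi i) :
    empiricalDeviation p (fun x => Real.log (Q x)) xs ≤
      -Real.log t * supDeviation p (LinearMap.range (kFactorSum Ωi k)) xs := by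
  set B := -Real.log t with hB
  have hB0 : 0 < B := neg_pos.2 (Real.log_neg ht0 ht1)
  have hl0 : (l : ℝ) ≠ 0 := by positivity
  set g : (∀ i, Ωi i) → ℝ := B⁻¹ • (fun x => Real.log (Q x)) + fun _ => 1 / 2 with hg
  have hgx (x) : Real.log (Q x) = B * (g x - 1 / 2) := by
    simp [hg]; field_simp
  have hmem : g ∈ halfBall (LinearMap.range (kFactorSum Ωi k)) := by
    refine ⟨Submodule.add_mem _ (Submodule.smul_mem _ _ (log_mem_range_kFactorSum hQ))
      (const_mem_range_kFactorSum Ωi hkn _), fun x => ?_⟩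
    have h1 : Real.log (Q x) ≤ 0 :=
      Real.log_nonpos (kFactorDists_pos hQ x).le (kFactorDists_le_one hQ x)
    have h2 : -B ≤ Real.log (Q x) := by
      rw [hB, neg_neg]; exact Real.log_le_log ht0 (hQt x)
    rw [hgx] at h1 h2
    rw [abs_le]
    constructor
    · by_contra! h; nlinarith
    · by_contra! h; nlinarith
  have hdev : empiricalDeviation p (fun x => Real.log (Q x)) xs =
      B * empiricalDeviation p g xs := by
    simp only [empiricalDeviation, hgx, mul_left_comm _ B, ← Finset.mul_sum, mul_sub,
      Finset.sum_sub_distrib, ← Finset.sum_mul, hp1, Finset.sum_const, Finset.card_univ,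
      Fintype.card_fin, nsmul_eq_mul]
    field_simp
    ring
  rw [hdev]
  exact mul_le_mul_of_nonneg_left (empiricalDeviation_le_supDeviation hp0 hmem xs) hB0.le

end KFactor

lemma Nat.le_choose_of_pos_of_lt {n k : ℕ} (hk : 0 < k) (hkn : k < n) : n ≤ n.choose k := by
  induction n generalizing k with
  | zero => omega
  | succ n ih =>
    obtain ⟨k, rfl⟩ := Nat.exists_eq_succ_of_ne_zero hk.ne'
    rw [Nat.choose_succ_succ]
    rcases Nat.lt_or_ge (k + 1) n with h | h
    · have h1 := ih k.succ_pos h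
      have h2 : 0 < n.choose k := Nat.choose_pos (by omega)
      simp only [Nat.succ_eq_add_one] at h1 ⊢
      omega
    · obtain rfl : n = k + 1 := by omega
      simp

lemma mul_exp_neg_half_le {x : ℝ} (hx : 0 < x) : x * Real.exp (-(x / 2)) ≤ 8 / x := by
  have h := Real.quadratic_le_exp_of_nonneg (half_pos hx).le
  rw [Real.exp_neg, ← div_eq_mul_inv, div_le_div_iff₀ (Real.exp_pos _) hx]
  nlinarith

lemma sum_mul_exp_neg_half_le {n : ℕ} {h : ℕ → ℝ} (hh : ∀ k, (n.choose k : ℝ) ≤ h k) :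
    ∑ k ∈ Finset.Icc 1 n, h k * Real.exp (-(h k / 2)) ≤ 16 := by
  rcases Nat.eq_zero_or_pos n with rfl | hn
  · simp
  have hn0 : (0 : ℝ) < n := by exact_mod_cast hn
  have hterm (k : ℕ) (hk : k ∈ Finset.Icc 1 n) :
      h k * Real.exp (-(h k / 2)) ≤ 8 / n + if k = n then 8 else 0 := by
    rw [Finset.mem_Icc] at hk
    have hc : (0 : ℝ) < n.choose k := by exact_mod_cast Nat.choose_pos hk.2
    refine (mul_exp_neg_half_le (hc.trans_le (hh k))).trans ?_
    split_ifs with hkn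
    · have h1 : 1 ≤ h k := by simpa [hkn] using hh k
      have h2 : 8 / h k ≤ 8 := div_le_self (by norm_num) h1
      have h3 : 0 ≤ 8 / (n : ℝ) := by positivity
      linarith
    · have h1 : (n : ℝ) ≤ n.choose k := by
        exact_mod_cast Nat.le_choose_of_pos_of_lt hk.1 (lt_of_le_of_ne hk.2 hkn)
      rw [add_zero]
      exact div_le_div_of_nonneg_left (by norm_num) hn0 (h1.trans (hh k))
  refine (Finset.sum_le_sum hterm).trans_eq ?_
  rw [Finset.sum_add_distrib, Finset.sum_ite_eq', if_pos (Finset.mem_Icc.2 ⟨hn, le_rfl⟩)]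
  simp
  field_simp
  norm_num

/-- Structural risk minimization bound: with probability at least `1 - η`,
simultaneously for all `k, j ≥ 1` and all `P_t ∈ H_k^{λ_j}`, the risk is bounded by
the empirical risk plus `φ(k, λ_j, η ν(A_{kj}))`. -/
theorem srm_risk_bound_kFactor {n : ℕ} (hn : 1 ≤ n) (Ωi : Fin n → Type*)
    [∀ i, Fintype (Ωi i)] [∀ i, Nonempty (Ωi i)]
    [MeasurableSpace (∀ i, Ωi i)] [MeasurableSingletonClass (∀ i, Ωi i)]
    (μ : Measure (∀ i, Ωi i)) [IsProbabilityMeasure μ]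
    (P : (∀ i, Ωi i) → ℝ) (hP : ∀ x, P x = (μ {x}).toReal)
    (m : Fin n → ℕ) (hm : ∀ i, m i = Fintype.card (Ωi i))
    (lam : ℕ → ℝ) (hlam_anti : StrictAnti lam)
    (hlam01 : ∀ j, 0 < lam j ∧ lam j < 1)
    (hlam_lim : Filter.Tendsto lam Filter.atTop (nhds 0))
    (ν : ℕ × ℕ → ℝ) (hν_pos : ∀ p, 0 < ν p) (hν_sum : ∑' p, ν p = 1)
    (h : ℕ → ℝ)
    (hh : ∀ k, h k = ∑ J ∈ Finset.univ.powersetCard k, ∏ i ∈ J, (m i : ℝ))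
    (l : ℕ) (hl : 1 ≤ l) (η : ℝ) (hη0 : 0 < η) (hη1 : η < 1) :
    ENNReal.ofReal (1 - η) ≤
      (Measure.pi fun _ : Fin l => μ)
        {xs | ∀ k j : ℕ, 1 ≤ k → 1 ≤ j →
          ∀ Pt ∈ kFactorDists Ωi k, (∀ x, lam j ≤ Pt x) →
            -(∑ x, P x * Real.log (Pt x)) ≤
              -((1 / (l : ℝ)) * ∑ i, Real.log (Pt (xs i))) +
                (-Real.log (lam j)) *
                  Real.sqrt ((h k - Real.log (h k) + Real.log 16 + Real.log l -
                      Real.log (η * ∑ p ∈ Finset.Icc 1 k ×ˢ Finset.Icc 1 j, ν p)) / l)} := by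
  classical
  have hl0 : (0 : ℝ) < l := by exact_mod_cast hl
  have hPμ : P = fun x => μ.real {x} := funext hP
  have hP0 : ∀ x, 0 ≤ P x := fun x => by rw [hPμ]; exact measureReal_nonneg
  have hP1 : ∑ x, P x = 1 := by rw [hPμ]; exact sum_real_singleton μ
  simp only [hm] at hh
  have hchoose (k : ℕ) : (n.choose k : ℝ) ≤ h k := hh k ▸ choose_le_sum_prod_card k
  set R : ℕ → ℝ := fun k =>
    h k - Real.log (h k) + Real.log 16 + Real.log l - Real.log η with hRdef
  let V : ℕ → Submodule ℝ ((∀ i, Ωi i) → ℝ) := fun k => LinearMap.range (kFactorSum Ωi k)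
  set bad : ℕ → Set (Fin l → ∀ i, Ωi i) := fun k => {xs | √(R k / l) < supDeviation P (V k) xs}
  have hlogl : 0 ≤ Real.log l := Real.log_nonneg (by exact_mod_cast hl)
  have hlog16 : 0 ≤ Real.log 16 := Real.log_nonneg (by norm_num)
  have hlogη : Real.log η ≤ 0 := Real.log_nonpos hη0.le hη1.le
  have hbad_le (k : ℕ) (hk : k ∈ Finset.Icc 1 n) :
      (Measure.pi fun _ : Fin l => μ).real (bad k) ≤ η / 16 * (h k * Real.exp (-(h k / 2))) := by
    have hk0 : 0 < h k := lt_of_lt_of_le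
      (by exact_mod_cast Nat.choose_pos (Finset.mem_Icc.1 hk).2) (hchoose k)
    have hR0 : 0 ≤ R k := by
      have := Real.log_le_self hk0.le
      simp only [hRdef]
      linarith
    have htail := measureReal_pi_lt_supDeviation_le μ (V k)
      ((finrank_range_kFactorSum_le Ωi k).trans_eq (hh k).symm) hl hR0
    rw [← hPμ] at htail
    calc _ ≤ _ := htail
      _ ≤ Real.exp (Real.log η - Real.log 16 + (Real.log (h k) + -(h k / 2))) := by
          rw [Real.exp_le_exp]
          simp only [hRdef]
          linarith
      _ = _ := by
          rw [Real.exp_add, Real.exp_sub, Real.exp_add, Real.exp_log hη0, Real.exp_log hk0,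
            Real.exp_log (by norm_num)]
  set U := ⋃ k ∈ Finset.Icc 1 n, bad k
  have hUle : (Measure.pi fun _ : Fin l => μ).real U ≤ η := by
    calc _ ≤ ∑ k ∈ Finset.Icc 1 n, (Measure.pi fun _ : Fin l => μ).real (bad k) :=
          measureReal_biUnion_finset_le _ _
      _ ≤ ∑ k ∈ Finset.Icc 1 n, η / 16 * (h k * Real.exp (-(h k / 2))) :=
          Finset.sum_le_sum hbad_le
      _ = η / 16 * ∑ k ∈ Finset.Icc 1 n, h k * Real.exp (-(h k / 2)) := by rw [Finset.mul_sum]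
      _ ≤ η / 16 * 16 :=
          mul_le_mul_of_nonneg_left (sum_mul_exp_neg_half_le hchoose) (by positivity)
      _ = η := by ring
  have hUc : ENNReal.ofReal (1 - η) ≤ (Measure.pi fun _ : Fin l => μ) Uᶜ := by
    rw [← ofReal_measureReal]
    refine ENNReal.ofReal_le_ofReal ?_
    rw [probReal_compl_eq_one_sub U.toFinite.measurableSet]
    linarith
  refine hUc.trans (measure_mono fun xs hxs k j hk hj Q hQ hQlam => ?_)
  have hB : 0 ≤ -Real.log (lam j) :=
    neg_nonneg.2 (Real.log_nonpos (hlam01 j).1.le (hlam01 j).2.le)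
  rcases lt_or_ge n k with hkn | hkn
  · simp only [kFactorDists_eq_one_of_lt hkn hQ, Real.log_one, mul_zero, Finset.sum_const_zero,
      neg_zero, zero_add]
    exact mul_nonneg hB (Real.sqrt_nonneg _)
  have hsup : supDeviation P (V k) xs ≤ √(R k / l) := by
    by_contra! hlt
    exact hxs (Set.mem_biUnion (Finset.mem_Icc.2 ⟨hk, hkn⟩) hlt)
  set s := ∑ p ∈ Finset.Icc 1 k ×ˢ Finset.Icc 1 j, ν p
  have hs0 : 0 < s := Finset.sum_pos (fun p _ => hν_pos p)
    ⟨(1, 1), by simp [hk, hj]⟩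
  have hs1 : s ≤ 1 := by
    have hsum : Summable ν := by
      by_contra hns
      simp [tsum_eq_zero_of_not_summable hns] at hν_sum
    exact (hsum.sum_le_tsum _ fun p _ => (hν_pos p).le).trans_eq hν_sum
  have hlogs : Real.log (η * s) ≤ Real.log η :=
    Real.log_le_log (mul_pos hη0 hs0) (mul_le_of_le_one_right hη0.le hs1)
  have hdev := empiricalDeviation_log_le hP0 hP1 hkn (hlam01 j).1 (hlam01 j).2 hQ hQlam hl xs
  have hfinal : -Real.log (lam j) * supDeviation P (V k) xs ≤ -Real.log (lam j) *
      √((h k - Real.log (h k) + Real.log 16 + Real.log l - Real.log (η * s)) / l) := by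
    refine mul_le_mul_of_nonneg_left (hsup.trans (Real.sqrt_le_sqrt ?_)) hB
    simp only [hRdef]
    gcongr
  rw [empiricalDeviation] at hdev
  linarith
end

section
/- Let Ω = Ω₁ × ⋯ × Ω_n with each Ω_i a nonempty finite set, and let P be a strictly positive probability distribution on Ω. Fix i ∈ {1,…,n}. For S ⊆ {1,…,n} and x ∈ Ω, write P(x_i | x_S) = (Σ_{y∈Ω : y_S = x_S and y_i = x_i} P(y)) / (Σ_{y∈Ω : y_S = x_S} P(y)). Call B ⊆ {1,…,n} \ {i} a Markov blanket of i if P(x_i | x_{{1,…,n}\{i}}) = P(x_i | x_B) for all x ∈ Ω. If B₁ and B₂ are Markov blankets of i, then B₁ ∩ B₂ is a Markov blanket of i; consequently, i has a unique inclusion-minimal Markov blanket (the Markov boundary of X_i). -/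
open Finset

section

variable {ι : Type*} [Fintype ι] [DecidableEq ι] {α : ι → Type*} [∀ j, Fintype (α j)]
  [∀ j, DecidableEq (α j)]

/-- Summing `P` over the points agreeing with `x` on `S` amounts to summing, over the points that
also agree with `x` at `i`, the sums of `P` along the lines in direction `i`. -/
theorem sum_sum_line_eq_sum_cylinder (P : (∀ j, α j) → ℝ) {i : ι} {S : Finset ι} (hi : i ∉ S)
    (x : ∀ j, α j) :
    ∑ y ∈ univ.filter (fun y : ∀ j, α j => (∀ j ∈ S, y j = x j) ∧ y i = x i),
        ∑ w ∈ univ.filter (fun w : ∀ j, α j => ∀ j ∈ univ \ {i}, w j = y j), P w =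
      ∑ w ∈ univ.filter (fun w : ∀ j, α j => ∀ j ∈ S, w j = x j), P w := by
  have hne : ∀ j ∈ S, j ≠ i := fun j hj h => hi (h ▸ hj)
  rw [← sum_fiberwise_of_maps_to (s := univ.filter (fun w : ∀ j, α j => ∀ j ∈ S, w j = x j))
    (g := fun w => Function.update w i (x i))
    (t := univ.filter (fun y : ∀ j, α j => (∀ j ∈ S, y j = x j) ∧ y i = x i))]
  · refine sum_congr rfl fun y hy => sum_congr ?_ fun _ _ => rfl
    obtain ⟨hyS, hyi⟩ := (mem_filter.1 hy).2
    ext w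
    simp only [mem_filter, mem_univ, true_and, mem_sdiff, mem_singleton]
    rw [Function.update_eq_iff]
    constructor
    · exact fun h => ⟨fun j hj => (h j (hne j hj)).trans (hyS j hj), hyi.symm, h⟩
    · exact fun h => h.2.2
  · intro w hw
    have hwS := (mem_filter.1 hw).2
    simp only [mem_filter, mem_univ, true_and, Function.update_self, and_true]
    intro j hj
    rw [Function.update_of_ne (hne j hj), hwS j hj]

/-- If the full conditional probability of `x i` given all other coordinates depends only on the
coordinates in `S` and on `x i`, then it equals the conditional probability given `S`. -/
theorem full_conditional_eq_of_dependsOn (P : (∀ j, α j) → ℝ) (hpos : ∀ x, 0 < P x) {i : ι}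
    {S : Finset ι} (hi : i ∉ S) (x : ∀ j, α j) (f : (∀ j, α j) → ℝ)
    (hf : ∀ y, f y =
      (∑ w ∈ univ.filter (fun w : ∀ j, α j => (∀ j ∈ univ \ {i}, w j = y j) ∧ w i = y i), P w) /
      (∑ w ∈ univ.filter (fun w : ∀ j, α j => ∀ j ∈ univ \ {i}, w j = y j), P w))
    (hdep : ∀ y, (∀ j ∈ S, y j = x j) → y i = x i → f y = f x) :
    f x =
      (∑ y ∈ univ.filter (fun y : ∀ j, α j => (∀ j ∈ S, y j = x j) ∧ y i = x i), P y) /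
      (∑ y ∈ univ.filter (fun y : ∀ j, α j => ∀ j ∈ S, y j = x j), P y) := by
  have hden : ∀ (T : Finset ι) (y : ∀ j, α j),
      0 < ∑ w ∈ univ.filter (fun w : ∀ j, α j => ∀ j ∈ T, w j = y j), P w := fun T y =>
    sum_pos (fun w _ => hpos w) ⟨y, by simp⟩
  have hP : ∀ y, P y =
      f y * ∑ w ∈ univ.filter (fun w : ∀ j, α j => ∀ j ∈ univ \ {i}, w j = y j), P w := by
    intro y
    have hsing : univ.filter
        (fun w : ∀ j, α j => (∀ j ∈ univ \ {i}, w j = y j) ∧ w i = y i) = {y} := by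
      ext w
      simp only [mem_filter, mem_univ, true_and, mem_sdiff, mem_singleton]
      constructor
      · rintro ⟨h, h'⟩
        funext j
        by_cases hj : j = i
        · subst hj
          exact h'
        · exact h j hj
      · rintro rfl
        simp
    rw [hf y, div_mul_cancel₀ _ (hden _ y).ne', hsing, sum_singleton]
  rw [eq_div_iff (hden S x).ne', ← sum_sum_line_eq_sum_cylinder P hi x, mul_sum]
  refine sum_congr rfl fun y hy => ?_
  obtain ⟨hyS, hyi⟩ := (mem_filter.1 hy).2
  rw [hP y, hdep y hyS hyi]

end

/-- A predicate on finsets that is nonempty and closed under intersection has a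
unique least element. -/
theorem existsUnique_least_of_inter {ι : Type*} [DecidableEq ι] {p : Finset ι → Prop}
    (hne : ∃ B, p B) (hinter : ∀ B₁ B₂, p B₁ → p B₂ → p (B₁ ∩ B₂)) :
    ∃! B, p B ∧ ∀ B', p B' → B ⊆ B' := by
  obtain ⟨B, hB⟩ := exists_minimal_of_wellFoundedLT p hne
  refine ⟨B, ⟨hB.1, fun B' hB' => ?_⟩, fun C hC => ?_⟩
  · exact (hB.2 (hinter B B' hB.1 hB') inter_subset_left).trans inter_subset_right
  · exact (hC.2 B hB.1).antisymm (hB.2 hC.1 (hC.2 B hB.1))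

/-- The intersection of two Markov blankets of a variable `i` (for a strictly positive
distribution) is again a Markov blanket of `i`; consequently `i` has a unique
inclusion-minimal Markov blanket, the Markov boundary of `X_i`. -/
theorem markov_blanket_inter {n : ℕ} (hn : 1 ≤ n) (Ωi : Fin n → Type*)
    [∀ i, Fintype (Ωi i)] [∀ i, Nonempty (Ωi i)] [∀ i, DecidableEq (Ωi i)]
    (P : (∀ i, Ωi i) → ℝ) (hpos : ∀ x, 0 < P x) (hsum : ∑ x, P x = 1)
    (i : Fin n)
    (cond : Finset (Fin n) → (∀ j, Ωi j) → ℝ)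
    (hcond : ∀ S x, cond S x =
        (∑ y ∈ Finset.univ.filter (fun y : ∀ j, Ωi j =>
            (∀ j ∈ S, y j = x j) ∧ y i = x i), P y) /
        (∑ y ∈ Finset.univ.filter (fun y : ∀ j, Ωi j => ∀ j ∈ S, y j = x j), P y))
    (blanket : Finset (Fin n) → Prop)
    (hblanket : ∀ B, blanket B ↔
        (i ∉ B ∧ ∀ x, cond (Finset.univ \ {i}) x = cond B x)) :
    (∀ B₁ B₂, blanket B₁ → blanket B₂ → blanket (B₁ ∩ B₂)) ∧
    (∃! B, blanket B ∧ ∀ B', blanket B' → B ⊆ B') := by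
  have hdep : ∀ B, blanket B → ∀ x y : ∀ j, Ωi j, (∀ j ∈ B, y j = x j) → y i = x i →
      cond (univ \ {i}) y = cond (univ \ {i}) x := by
    intro B hB x y hyB hyi
    have h := ((hblanket B).1 hB).2
    rw [h y, h x, hcond B y, hcond B x, hyi]
    have hcyl : ∀ w : ∀ j, Ωi j, (∀ j ∈ B, w j = y j) ↔ ∀ j ∈ B, w j = x j := fun w =>
      forall₂_congr fun j hj => by rw [hyB j hj]
    simp only [hcyl]
  have hinter : ∀ B₁ B₂, blanket B₁ → blanket B₂ → blanket (B₁ ∩ B₂) := by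
    intro B₁ B₂ h₁ h₂
    have hi : i ∉ B₁ ∩ B₂ := fun h => ((hblanket B₁).1 h₁).1 (mem_inter.1 h).1
    refine (hblanket _).2 ⟨hi, fun x => ?_⟩
    rw [hcond (B₁ ∩ B₂) x]
    convert full_conditional_eq_of_dependsOn P hpos hi x (cond (univ \ {i}))
      (fun y => by convert hcond (univ \ {i}) y) fun y hy hyi => ?_
    let z : ∀ j, Ωi j := fun j => if j ∈ B₁ then x j else y j
    have hzi : z i = y i := if_neg ((hblanket B₁).1 h₁).1
    refine (hdep B₂ h₂ y z (fun j hj => ?_) hzi).symm.trans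
      (hdep B₁ h₁ x z (fun j hj => if_pos hj) (hzi.trans hyi))
    by_cases hj₁ : j ∈ B₁
    · exact (if_pos hj₁).trans (hy j (mem_inter.2 ⟨hj₁, hj⟩)).symm
    · exact if_neg hj₁
  exact ⟨hinter, existsUnique_least_of_inter
    ⟨univ \ {i}, (hblanket _).2 ⟨by simp, fun _ => rfl⟩⟩ hinter⟩
end
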